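/- For j ∈ ℕ let I_j = [2^{j−1}, 2^{j+1}] and let ℰ_j be a standard edge fragment. Then for angles θ, γ ∈ [0, 2π) and any multi-index r ∈ ℕ₀² there is a constant C(r) > 0 such that ∫_{|ρ| ∈ I_j} |∂^r[𝓕ℰ_j](ρ·Θ(θ − γ))|² dρ ≤ C(r) · 2^{−j(2 + |r|₁)} · (1 + 2^{j/2}|sin(θ − γ)|)^{−5}. -/

import Mathlib

open Real MeasureTheory Set
open scoped Classical

noncomputable section

/-- A window function `g ∈ 𝒲`: nonnegative, even, with support `(-2/3, 2/3)`,
and whose integer translates form a partition of unity. -/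
structure IsWindow (g : ℝ → ℝ) : Prop where
  nonneg : ∀ x, 0 ≤ g x
  even_fun : ∀ x, g (-x) = g x
  supp_eq : Function.support g = Ioo (-(2/3) : ℝ) (2/3)
  partition : ∀ x : ℝ, HasSum (fun z : ℤ => g (x + (z : ℝ))) 1

/-- `g ∈ 𝒲^q`: a window function that is `q`-times continuously differentiable. -/
def IsWindowQ (g : ℝ → ℝ) (q : ℕ) : Prop := IsWindow g ∧ ContDiff ℝ q g

/-- `g̃(x) = g(x/2) - g(x)`. -/
def gtilde (g : ℝ → ℝ) : ℝ → ℝ := fun x => g (x / 2) - g x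

/-- Horizontal bivariate window `Ψ^{(h)}(x) = g̃(x₁) g(x₂)`. -/
def PsiH (g : ℝ → ℝ) : ℝ × ℝ → ℝ := fun x => gtilde g x.1 * g x.2

/-- Vertical bivariate window `Ψ^{(v)}(x) = g(x₁) g̃(x₂)`. -/
def PsiV (g : ℝ → ℝ) : ℝ × ℝ → ℝ := fun x => g x.1 * gtilde g x.2

/-- `Ψ_{j,ℓ}^{(i)}(ξ) = Ψ^{(i)}((N_{j,ℓ}^{(i)})^{-T} ξ)`, where the inverse transpose of the
shear matrices has been written out explicitly.  `i = true` is the horizontal case `(h)`,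
`i = false` the vertical case `(v)`. -/
def PsiJL (g : ℝ → ℝ) (i : Bool) (j : ℕ) (ℓ : ℤ) : ℝ × ℝ → ℝ := fun ξ =>
  if i then
    PsiH g ((2:ℝ) ^ (-(j:ℝ)) * ξ.1,
            (2:ℝ) ^ (-(j:ℝ)/2) * ξ.2 - (ℓ:ℝ) * (2:ℝ) ^ (-(j:ℝ)) * ξ.1)
  else
    PsiV g ((2:ℝ) ^ (-(j:ℝ)/2) * ξ.1 - (ℓ:ℝ) * (2:ℝ) ^ (-(j:ℝ)) * ξ.2,
            (2:ℝ) ^ (-(j:ℝ)) * ξ.2)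

/-- Discrete angles `θ_{j,ℓ}^{(h)} = arctan(ℓ 2^{-j/2})`,
`θ_{j,ℓ}^{(v)} = arccot(ℓ 2^{-j/2}) = π/2 - arctan(ℓ 2^{-j/2})`. -/
def thetaJL (i : Bool) (j : ℕ) (ℓ : ℤ) : ℝ :=
  if i then arctan ((ℓ:ℝ) * (2:ℝ) ^ (-(j:ℝ)/2))
  else π/2 - arctan ((ℓ:ℝ) * (2:ℝ) ^ (-(j:ℝ)/2))

/-- The pattern `𝒫(N_{j,ℓ}^{(i)}) = (N_{j,ℓ}^{(i)})^{-1} ℤ² ∩ [-1/2,1/2)²`: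
`y` belongs to the pattern iff `N_{j,ℓ}^{(i)} y ∈ ℤ²` and `y ∈ [-1/2,1/2)²`. -/
def pattern (i : Bool) (j : ℕ) (ℓ : ℤ) : Set (ℝ × ℝ) :=
  {y : ℝ × ℝ |
    (∃ k : ℤ × ℤ,
      (if i then ((2:ℝ)^(j:ℝ) * y.1 + (ℓ:ℝ) * (2:ℝ)^((j:ℝ)/2) * y.2, (2:ℝ)^((j:ℝ)/2) * y.2)
       else ((2:ℝ)^((j:ℝ)/2) * y.1, (ℓ:ℝ) * (2:ℝ)^((j:ℝ)/2) * y.1 + (2:ℝ)^(j:ℝ) * y.2))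
        = ((k.1 : ℝ), (k.2 : ℝ)))
    ∧ y.1 ∈ Ico (-(1/2) : ℝ) (1/2) ∧ y.2 ∈ Ico (-(1/2) : ℝ) (1/2)}

/-- `ỹ = y - (2^{-j-1},0)ᵀ` in the horizontal case, `ỹ = y - (0,2^{-j-1})ᵀ` in the vertical one. -/
def ytilde (i : Bool) (j : ℕ) (y : ℝ × ℝ) : ℝ × ℝ :=
  if i then (y.1 - (2:ℝ) ^ (-(j:ℝ) - 1), y.2) else (y.1, y.2 - (2:ℝ) ^ (-(j:ℝ) - 1))

/-- The trigonometric polynomial shearlet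
`ψ_{j,ℓ,y}^{(i)}(x) = ∑_{k∈ℤ²} Ψ_{j,ℓ}^{(i)}(k) e^{i k·(x - 2πỹ)}`. -/
def shearlet (g : ℝ → ℝ) (i : Bool) (j : ℕ) (ℓ : ℤ) (y : ℝ × ℝ) : ℝ × ℝ → ℂ := fun x =>
  ∑' k : ℤ × ℤ, (PsiJL g i j ℓ ((k.1 : ℝ), (k.2 : ℝ)) : ℂ) *
    Complex.exp (Complex.I *
      (((k.1 : ℝ) * (x.1 - 2*π*(ytilde i j y).1)
        + (k.2 : ℝ) * (x.2 - 2*π*(ytilde i j y).2) : ℝ) : ℂ))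

/-- `⟨f,h⟩₂ = (2π)^{-2} ∫_{𝕋²} f(x) conj(h(x)) dx`, with the torus realised as `[-π,π]²`. -/
def inner2 (f h : ℝ × ℝ → ℂ) : ℂ :=
  ((2*π)^2 : ℂ)⁻¹ * ∫ x in (Icc (-π) π ×ˢ Icc (-π) π : Set (ℝ × ℝ)), f x * (starRingEnd ℂ) (h x)

/-- The `2π`-periodization `f^{2π} = ∑_{n∈ℤ²} f(· + 2πn)`. -/
def periodize (f : ℝ × ℝ → ℝ) : ℝ × ℝ → ℝ := fun x =>
  ∑' n : ℤ × ℤ, f (x.1 + 2*π*(n.1 : ℝ), x.2 + 2*π*(n.2 : ℝ))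

/-- Euclidean norm `|x|₂` on `ℝ²`. -/
def nrm2 (x : ℝ × ℝ) : ℝ := Real.sqrt (x.1^2 + x.2^2)

/-- First partial derivative of a complex-valued function of two real variables. -/
def pd1 (f : ℝ × ℝ → ℂ) : ℝ × ℝ → ℂ := fun x => deriv (fun t => f (t, x.2)) x.1

/-- Second partial derivative of a complex-valued function of two real variables. -/
def pd2 (f : ℝ × ℝ → ℂ) : ℝ × ℝ → ℂ := fun x => deriv (fun t => f (x.1, t)) x.2

/-- `∂^r = ∂^{r₁+r₂}/∂x₁^{r₁}∂x₂^{r₂}` (complex-valued). -/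
def pd (r : ℕ × ℕ) (f : ℝ × ℝ → ℂ) : ℝ × ℝ → ℂ := pd1^[r.1] (pd2^[r.2] f)

/-- First partial derivative of a real-valued function of two real variables. -/
def pdR1 (f : ℝ × ℝ → ℝ) : ℝ × ℝ → ℝ := fun x => deriv (fun t => f (t, x.2)) x.1

/-- Second partial derivative of a real-valued function of two real variables. -/
def pdR2 (f : ℝ × ℝ → ℝ) : ℝ × ℝ → ℝ := fun x => deriv (fun t => f (x.1, t)) x.2

/-- `∂^r = ∂^{r₁+r₂}/∂x₁^{r₁}∂x₂^{r₂}` (real-valued). -/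
def pdR (r : ℕ × ℕ) (f : ℝ × ℝ → ℝ) : ℝ × ℝ → ℝ := pdR1^[r.1] (pdR2^[r.2] f)

/-- The Fourier transform `𝓕f(x) = (2π)^{-2} ∫_{ℝ²} f(ξ) e^{-iξ·x} dξ`. -/
def FT (f : ℝ × ℝ → ℂ) : ℝ × ℝ → ℂ := fun x =>
  ((2*π)^2 : ℂ)⁻¹ * ∫ ξ : ℝ × ℝ, f ξ * Complex.exp (-(Complex.I) * ((ξ.1*x.1 + ξ.2*x.2 : ℝ) : ℂ))

/-- Rotation matrix `R_γ` acting on `ℝ²`. -/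
def rotM (γ : ℝ) (x : ℝ × ℝ) : ℝ × ℝ :=
  (Real.cos γ * x.1 - Real.sin γ * x.2, Real.sin γ * x.1 + Real.cos γ * x.2)

/-- Transposed rotation matrix `R_γᵀ` acting on `ℝ²`. -/
def rotT (γ : ℝ) (x : ℝ × ℝ) : ℝ × ℝ :=
  (Real.cos γ * x.1 + Real.sin γ * x.2, -(Real.sin γ) * x.1 + Real.cos γ * x.2)

/-- The standard edge fragment `ℰ_j(x) = f(x) φ(2^{j/2}x) χ_{{x₁ ≥ E(x₂)}}(x)`. -/
def edgeFragment (f φ : ℝ × ℝ → ℝ) (E : ℝ → ℝ) (j : ℕ) : ℝ × ℝ → ℝ := fun x =>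
  f x * φ ((2:ℝ)^((j:ℝ)/2) * x.1, (2:ℝ)^((j:ℝ)/2) * x.2) * (if E x.2 ≤ x.1 then 1 else 0)

/-- The second-order differential operator `L = I + 2^j Δ`. -/
def Lop (j : ℕ) (f : ℝ × ℝ → ℂ) : ℝ × ℝ → ℂ := fun x =>
  f x + (Complex.ofReal ((2:ℝ)^(j:ℝ))) * (pd (2,0) f x + pd (0,2) f x)

/-- The dyadic square `Q` indexed by `(n₁,n₂)` at scale `j`. -/
def dyadicSquare (j : ℕ) (n : ℕ × ℕ) : Set (ℝ × ℝ) :=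
  Ico (2*π*(n.1:ℝ)*(2:ℝ)^(-(j:ℝ)/2) - π) (2*π*((n.1:ℝ)+1)*(2:ℝ)^(-(j:ℝ)/2) - π) ×ˢ
  Ico (2*π*(n.2:ℝ)*(2:ℝ)^(-(j:ℝ)/2) - π) (2*π*((n.2:ℝ)+1)*(2:ℝ)^(-(j:ℝ)/2) - π)

/-- The indices of the dyadic squares at scale `j` meeting `∂T` (the set `𝒬_j^1`). -/
def Q1set (T : Set (ℝ × ℝ)) (j : ℕ) : Finset (ℕ × ℕ) :=
  (Finset.range (2^(j/2)) ×ˢ Finset.range (2^(j/2))).filter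
    (fun n => (frontier T ∩ dyadicSquare j n).Nonempty)

/-- Fresnel integral `Fc(x) = ∫₀ˣ cos v/√v dv`. -/
def Fc (x : ℝ) : ℝ := ∫ v in (0:ℝ)..x, Real.cos v / Real.sqrt v

/-- Fresnel integral `Fs(x) = ∫₀ˣ sin v/√v dv`. -/
def Fs (x : ℝ) : ℝ := ∫ v in (0:ℝ)..x, Real.sin v / Real.sqrt v

/-- `F⁺ = Fc + Fs`. -/
def Fp (x : ℝ) : ℝ := Fc x + Fs x

/-- `F⁻ = Fc - Fs`. -/
def Fm (x : ℝ) : ℝ := Fc x - Fs x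

/-- `a(λ,p,A)` of the paper. -/
def aInt (g : ℝ → ℝ) (l p A : ℝ) : ℝ :=
  ∫ v in Ioi (0:ℝ),
    (g (2*Real.sqrt (A*l*v) + p*l) + g (2*Real.sqrt (A*l*v) - p*l)) * (Real.cos v / Real.sqrt v)

/-- `b(λ,p,A)` of the paper. -/
def bInt (g : ℝ → ℝ) (l p A : ℝ) : ℝ :=
  ∫ v in Ioi (0:ℝ),
    (g (2*Real.sqrt (A*l*v) + p*l) + g (2*Real.sqrt (A*l*v) - p*l)) * (Real.sin v / Real.sqrt v)

/-- `P₁(D,p,A)` of the paper. -/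
def P1 (g : ℝ → ℝ) (D p A : ℝ) : ℝ :=
  ∫ l in (1/3 : ℝ)..(4/3),
    gtilde g l * l⁻¹ *
      ((aInt g l p A + bInt g l p A) * Real.cos (D*l)
        + (aInt g l p A - bInt g l p A) * Real.sin (D*l))

/-- `P₂(D,p,A)` of the paper. -/
def P2 (g : ℝ → ℝ) (D p A : ℝ) : ℝ :=
  ∫ l in (1/3 : ℝ)..(4/3),
    gtilde g l * l⁻¹ *
      ((aInt g l p A + bInt g l p A) * Real.sin (D*l)
        - (aInt g l p A - bInt g l p A) * Real.cos (D*l))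

/-- The oscillatory integral `∫ k(x) e^{-iτp(x)} dμ(x)` with amplitude `k` and phase `p`. -/
def oscInt {X : Type*} [MeasurableSpace X] (μ : Measure X) (p k : X → ℝ) (τ : ℝ) : ℂ :=
  ∫ x, (k x : ℂ) * Complex.exp (-Complex.I * ((τ * p x : ℝ) : ℂ)) ∂μ

lemma norm_cexp_neg_I_mul (t : ℝ) : ‖Complex.exp (-Complex.I * (t : ℂ))‖ = 1 := by
  rw [show -Complex.I * (t : ℂ) = ((-t : ℝ) : ℂ) * Complex.I by push_cast; ring]
  exact Complex.norm_exp_ofReal_mul_I _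

section OscInt

variable {X : Type*} [MeasurableSpace X] {μ : Measure X} {p k k' : X → ℝ}

lemma integrable_oscInt_integrand (hp : AEStronglyMeasurable p μ) (hk : Integrable k μ) (τ : ℝ) :
    Integrable (fun x => (k x : ℂ) * Complex.exp (-Complex.I * ((τ * p x : ℝ) : ℂ))) μ := by
  have h1 : AEStronglyMeasurable
      (fun x => Complex.exp (-Complex.I * ((τ * p x : ℝ) : ℂ))) μ := by
    have hc : Continuous (fun t : ℝ => Complex.exp (-Complex.I * ((τ * t : ℝ) : ℂ))) := by
      fun_prop
    exact hc.comp_aestronglyMeasurable hp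
  refine (hk.ofReal (𝕜 := ℂ)).mul_bdd (c := 1) h1 ?_
  exact Filter.Eventually.of_forall fun x => (norm_cexp_neg_I_mul _).le

lemma oscInt_add (hp : AEStronglyMeasurable p μ) (hk : Integrable k μ) (hk' : Integrable k' μ)
    (τ : ℝ) : oscInt μ p (fun x => k x + k' x) τ = oscInt μ p k τ + oscInt μ p k' τ := by
  unfold oscInt
  rw [← integral_add (integrable_oscInt_integrand hp hk τ) (integrable_oscInt_integrand hp hk' τ)]
  congr 1
  ext x
  push_cast
  ring

lemma continuous_oscInt (hp : AEStronglyMeasurable p μ) (hk : Integrable k μ) :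
    Continuous (oscInt μ p k) := by
  unfold oscInt
  refine continuous_of_dominated (bound := fun x => ‖k x‖)
    (fun τ => (integrable_oscInt_integrand hp hk τ).aestronglyMeasurable) ?_ hk.norm ?_
  · intro τ
    refine Filter.Eventually.of_forall fun x => ?_
    rw [norm_mul, norm_cexp_neg_I_mul, mul_one, Complex.norm_real]
  · refine Filter.Eventually.of_forall fun x => ?_
    fun_prop

lemma norm_oscInt_le [IsFiniteMeasure μ] {K : ℝ} (hK : ∀ᵐ x ∂μ, |k x| ≤ K) (τ : ℝ) :
    ‖oscInt μ p k τ‖ ≤ K * μ.real univ := by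
  unfold oscInt
  refine norm_integral_le_of_norm_le_const ?_
  filter_upwards [hK] with x hx
  rw [norm_mul, norm_cexp_neg_I_mul, mul_one, Complex.norm_real]
  exact hx

lemma norm_integral_gaussian_mul_cexp {N : ℝ} (hN : 0 < N) (d : ℝ) :
    ‖∫ τ : ℝ, (Real.exp (-(N ^ 2)⁻¹ * τ ^ 2) : ℂ) * Complex.exp (-Complex.I * ((τ * d : ℝ) : ℂ))‖
      = √π * N * Real.exp (-(N ^ 2 / 4) * d ^ 2) := by
  have hb : 0 < ((N ^ 2)⁻¹ : ℝ) := by positivity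
  have h := fourierIntegral_gaussian (b := (((N ^ 2)⁻¹ : ℝ) : ℂ))
    (by rw [Complex.ofReal_re]; exact hb) ((-d : ℝ) : ℂ)
  have h2 : (∫ τ : ℝ, (Real.exp (-(N ^ 2)⁻¹ * τ ^ 2) : ℂ) *
      Complex.exp (-Complex.I * ((τ * d : ℝ) : ℂ))) =
      ∫ τ : ℝ, Complex.exp (Complex.I * ((-d : ℝ) : ℂ) * τ) *
        Complex.exp (-(((N ^ 2)⁻¹ : ℝ) : ℂ) * τ ^ 2) := by
    congr 1
    ext τ
    rw [mul_comm]
    congr 1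
    · congr 1
      push_cast
      ring
    · push_cast
      rfl
  rw [h2, h, norm_mul]
  congr 1
  · rw [← Complex.ofReal_div, show ((1 / 2 : ℂ)) = ((1 / 2 : ℝ) : ℂ) by push_cast; rfl,
      ← Complex.ofReal_cpow (by positivity), Complex.norm_real, ← Real.sqrt_eq_rpow]
    rw [Real.norm_of_nonneg (by positivity)]
    rw [div_inv_eq_mul, Real.sqrt_mul Real.pi_pos.le, Real.sqrt_sq hN.le]
  · rw [show -(((-d : ℝ) : ℂ)) ^ 2 / (4 * (((N ^ 2)⁻¹ : ℝ) : ℂ)) =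
      ((-(N ^ 2 / 4) * d ^ 2 : ℝ) : ℂ) by push_cast; field_simp]
    rw [← Complex.ofReal_exp, Complex.norm_real, Real.norm_of_nonneg (Real.exp_pos _).le]

/-- The frequency range `{τ : |τ| ∈ [N/2, 2N]}`. -/
def freqBand (N : ℝ) : Set ℝ := {τ | |τ| ∈ Icc (N / 2) (2 * N)}

lemma measurableSet_freqBand (N : ℝ) : MeasurableSet (freqBand N) :=
  measurable_norm measurableSet_Icc

lemma freqBand_subset (N : ℝ) : freqBand N ⊆ Icc (-(2 * N)) (2 * N) := fun _ h => abs_le.mp h.2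

lemma integrableOn_freqBand {F : ℝ → ℝ} (hF : Continuous F) (N : ℝ) :
    IntegrableOn F (freqBand N) :=
  (hF.integrableOn_Icc).mono_set (freqBand_subset N)

/-- A Schur-test form of Plancherel's theorem for oscillatory integrals. -/
lemma setIntegral_norm_oscInt_sq_le [IsFiniteMeasure μ] {K G N : ℝ} (hN : 0 < N)
    (hp : Measurable p) (hk : AEStronglyMeasurable k μ) (hK : ∀ᵐ x ∂μ, |k x| ≤ K)
    (hG : ∀ᵐ x ∂μ, ∫ y, Real.exp (-(N ^ 2 / 4) * (p x - p y) ^ 2) ∂μ ≤ G / N) :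
    ∫ τ in freqBand N, ‖oscInt μ p k τ‖ ^ 2 ≤ Real.exp 4 * (√π * K ^ 2 * (G * μ.real univ)) := by
  have hkint : Integrable k μ := Integrable.of_bound hk K hK
  have hcont := continuous_oscInt hp.aestronglyMeasurable hkint
  set w : ℝ → ℝ := fun τ => Real.exp (-(N ^ 2)⁻¹ * τ ^ 2) with hw
  have hwint : Integrable w := integrable_exp_neg_mul_sq (by positivity)
  have hwF : Integrable (fun τ => w τ * ‖oscInt μ p k τ‖ ^ 2) := by
    refine hwint.mul_bdd (c := (K * μ.real univ) ^ 2) (by fun_prop) ?_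
    refine Filter.Eventually.of_forall fun τ => ?_
    rw [norm_pow, norm_norm]
    exact pow_le_pow_left₀ (norm_nonneg _) (norm_oscInt_le hK τ) 2
  have step1 : ∫ τ in freqBand N, ‖oscInt μ p k τ‖ ^ 2 ≤
      Real.exp 4 * ∫ τ, w τ * ‖oscInt μ p k τ‖ ^ 2 := by
    rw [← integral_const_mul]
    refine (setIntegral_mono_on (integrableOn_freqBand (by fun_prop) N)
      (hwF.const_mul _).integrableOn (measurableSet_freqBand N) ?_).trans
      (setIntegral_le_integral (hwF.const_mul _)
        (Filter.Eventually.of_forall fun τ => by positivity))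
    intro τ hτ
    rw [← mul_assoc, hw, ← Real.exp_add]
    refine le_mul_of_one_le_left (by positivity) (Real.one_le_exp ?_)
    have h2 : τ ^ 2 ≤ (2 * N) ^ 2 := sq_le_sq' (freqBand_subset N hτ).1 (freqBand_subset N hτ).2
    have h3 : (N ^ 2)⁻¹ * τ ^ 2 ≤ (N ^ 2)⁻¹ * (2 * N) ^ 2 := by gcongr
    have h4 : (N ^ 2)⁻¹ * (2 * N) ^ 2 = 4 := by field_simp; norm_num
    linarith
  have hsq : ∀ τ, ((‖oscInt μ p k τ‖ ^ 2 : ℝ) : ℂ) = ∫ z : X × X, ((k z.1 * k z.2 : ℝ) : ℂ) *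
      Complex.exp (-Complex.I * ((τ * (p z.1 - p z.2) : ℝ) : ℂ)) ∂(μ.prod μ) := by
    intro τ
    rw [Complex.ofReal_pow, ← Complex.mul_conj']
    unfold oscInt
    rw [← integral_conj, ← integral_prod_mul]
    congr 1
    ext z
    simp only [map_mul, Complex.conj_ofReal, ← Complex.exp_conj, map_neg, Complex.conj_I]
    rw [mul_mul_mul_comm, ← Complex.exp_add]
    push_cast
    congr 2
    ring
  have hkk : Integrable (fun z : X × X => k z.1 * k z.2) (μ.prod μ) := hkint.mul_prod hkint
  have hpp : Measurable (fun z : X × X => p z.1 - p z.2) :=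
    (hp.comp measurable_fst).sub (hp.comp measurable_snd)
  have hfull : Integrable (Function.uncurry fun (τ : ℝ) (z : X × X) =>
      (w τ : ℂ) * (((k z.1 * k z.2 : ℝ) : ℂ) *
      Complex.exp (-Complex.I * ((τ * (p z.1 - p z.2) : ℝ) : ℂ)))) (volume.prod (μ.prod μ)) := by
    have h1 : Integrable (fun q : ℝ × (X × X) => (w q.1 : ℂ) * ((k q.2.1 * k q.2.2 : ℝ) : ℂ))
        (volume.prod (μ.prod μ)) :=
      (hwint.ofReal (𝕜 := ℂ)).mul_prod (hkk.ofReal (𝕜 := ℂ))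
    have h2 : Measurable (fun q : ℝ × (X × X) =>
        Complex.exp (-Complex.I * ((q.1 * (p q.2.1 - p q.2.2) : ℝ) : ℂ))) := by
      have : Measurable (fun q : ℝ × (X × X) => q.1 * (p q.2.1 - p q.2.2)) :=
        measurable_fst.mul (hpp.comp measurable_snd)
      exact (Complex.measurable_ofReal.comp this).const_mul _ |>.cexp
    have h3 := h1.mul_bdd (c := 1) h2.aestronglyMeasurable
      (Filter.Eventually.of_forall fun q => (norm_cexp_neg_I_mul _).le)
    refine h3.congr (Filter.Eventually.of_forall fun q => ?_)
    simp only [Function.uncurry]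
    ring
  have step2 : ((∫ τ, w τ * ‖oscInt μ p k τ‖ ^ 2 : ℝ) : ℂ) =
      ∫ z : X × X, ((k z.1 * k z.2 : ℝ) : ℂ) * (∫ τ : ℝ, (w τ : ℂ) *
      Complex.exp (-Complex.I * ((τ * (p z.1 - p z.2) : ℝ) : ℂ))) ∂(μ.prod μ) := by
    rw [← integral_complex_ofReal]
    calc _ = ∫ τ : ℝ, ∫ z : X × X, (w τ : ℂ) * (((k z.1 * k z.2 : ℝ) : ℂ) *
        Complex.exp (-Complex.I * ((τ * (p z.1 - p z.2) : ℝ) : ℂ))) ∂(μ.prod μ) := by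
          congr 1
          ext τ
          rw [integral_const_mul, ← hsq]
          push_cast
          rfl
      _ = _ := by
          rw [integral_integral_swap hfull]
          congr 1
          ext z
          rw [← integral_const_mul]
          congr 1
          ext τ
          ring
  have hexpint : Integrable (fun z : X × X => Real.exp (-(N ^ 2 / 4) * (p z.1 - p z.2) ^ 2))
      (μ.prod μ) := by
    refine Integrable.of_bound (C := 1) ?_ ?_
    · exact ((hpp.pow_const 2).const_mul _).exp.aestronglyMeasurable
    · refine Filter.Eventually.of_forall fun z => ?_
      rw [Real.norm_of_nonneg (Real.exp_pos _).le, Real.exp_le_one_iff]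
      have : 0 ≤ N ^ 2 / 4 * (p z.1 - p z.2) ^ 2 := by positivity
      linarith
  have step3 : ∫ τ, w τ * ‖oscInt μ p k τ‖ ^ 2 ≤
      ∫ z : X × X, K ^ 2 * (√π * N * Real.exp (-(N ^ 2 / 4) * (p z.1 - p z.2) ^ 2))
        ∂(μ.prod μ) := by
    have h0 : 0 ≤ ∫ τ, w τ * ‖oscInt μ p k τ‖ ^ 2 := integral_nonneg fun τ => by positivity
    rw [← Real.norm_of_nonneg h0, ← Complex.norm_real, step2]
    refine norm_integral_le_of_norm_le ((hexpint.const_mul _).const_mul _) ?_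
    have hK1 : ∀ᵐ z ∂(μ.prod μ), |k z.1| ≤ K := Measure.quasiMeasurePreserving_fst.ae hK
    have hK2 : ∀ᵐ z ∂(μ.prod μ), |k z.2| ≤ K := Measure.quasiMeasurePreserving_snd.ae hK
    filter_upwards [hK1, hK2] with z hz1 hz2
    rw [norm_mul, norm_integral_gaussian_mul_cexp hN, Complex.norm_real, norm_mul, sq K]
    refine mul_le_mul_of_nonneg_right ?_ (by positivity)
    exact mul_le_mul hz1 hz2 (norm_nonneg _) ((abs_nonneg _).trans hz1)
  refine step1.trans (mul_le_mul_of_nonneg_left (step3.trans ?_) (Real.exp_pos _).le)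
  rw [integral_const_mul, integral_const_mul, integral_prod _ hexpint]
  have step4 : ∫ x, ∫ y, Real.exp (-(N ^ 2 / 4) * (p x - p y) ^ 2) ∂μ ∂μ ≤
      ∫ _x, G / N ∂μ :=
    integral_mono_ae hexpint.integral_prod_left (integrable_const _) hG
  rw [integral_const, smul_eq_mul] at step4
  calc _ ≤ K ^ 2 * (√π * N * (μ.real univ * (G / N))) := by gcongr
    _ = _ := by field_simp

end OscInt

/-- Lebesgue measure on `(-4, 4]`. -/
def lineMeasure : Measure ℝ := volume.restrict (Ioc (-4) 4)

instance : IsFiniteMeasure lineMeasure := by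
  unfold lineMeasure
  infer_instance

lemma lineMeasure_real_univ : lineMeasure.real univ = 8 := by
  simp [lineMeasure, Measure.real]
  norm_num

lemma ae_lineMeasure {P : ℝ → Prop} (h : ∀ v ∈ Icc (-4 : ℝ) 4, P v) : ∀ᵐ v ∂lineMeasure, P v := by
  unfold lineMeasure
  filter_upwards [ae_restrict_mem measurableSet_Ioc] with v hv
  exact h v (Ioc_subset_Icc_self hv)

lemma integrable_lineMeasure {a : ℝ → ℝ} (ha : ContinuousOn a (Icc (-4) 4)) :
    Integrable a lineMeasure :=
  (ha.integrableOn_Icc).mono_set Ioc_subset_Icc_self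

lemma setIntegral_freqBand_le_of_I_mul {F G : ℝ → ℂ} {N : ℝ} (hN : 0 < N) (hF : Continuous F)
    (hG : Continuous G) (h : ∀ τ : ℝ, Complex.I * τ * F τ = G τ) :
    ∫ τ in freqBand N, ‖F τ‖ ^ 2 ≤ 4 / N ^ 2 * ∫ τ in freqBand N, ‖G τ‖ ^ 2 := by
  rw [← integral_const_mul]
  refine setIntegral_mono_on (integrableOn_freqBand (by fun_prop) N)
    (integrableOn_freqBand (by fun_prop) N) (measurableSet_freqBand N) fun τ hτ => ?_
  have hn : ‖G τ‖ = |τ| * ‖F τ‖ := by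
    rw [← h τ, norm_mul, norm_mul, Complex.norm_I, one_mul, Complex.norm_real, Real.norm_eq_abs]
  rw [hn, mul_pow, ← mul_assoc]
  refine le_mul_of_one_le_left (by positivity) ?_
  have h1 : (N / 2) ^ 2 ≤ |τ| ^ 2 := pow_le_pow_left₀ (by positivity) hτ.1 2
  rw [div_mul_eq_mul_div, one_le_div (by positivity)]
  linarith

lemma setIntegral_freqBand_add_le {F G : ℝ → ℂ} (N : ℝ) (hF : Continuous F)
    (hG : Continuous G) :
    ∫ τ in freqBand N, ‖F τ + G τ‖ ^ 2 ≤
      2 * (∫ τ in freqBand N, ‖F τ‖ ^ 2) + 2 * ∫ τ in freqBand N, ‖G τ‖ ^ 2 := by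
  rw [← integral_const_mul, ← integral_const_mul, ← integral_add
    (integrableOn_freqBand (by fun_prop) N) (integrableOn_freqBand (by fun_prop) N)]
  refine setIntegral_mono_on (integrableOn_freqBand (by fun_prop) N)
    (integrableOn_freqBand (by fun_prop) N) (measurableSet_freqBand N) fun τ _ => ?_
  have h1 := pow_le_pow_left₀ (norm_nonneg _) (norm_add_le (F τ) (G τ)) 2
  nlinarith [sq_nonneg (‖F τ‖ - ‖G τ‖)]

lemma setIntegral_freqBand_const_mul (a : ℂ) (F : ℝ → ℂ) (N : ℝ) :
    ∫ τ in freqBand N, ‖a * F τ‖ ^ 2 = ‖a‖ ^ 2 * ∫ τ in freqBand N, ‖F τ‖ ^ 2 := by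
  rw [← integral_const_mul]
  congr 1
  ext τ
  rw [norm_mul, mul_pow]

/-- Integration by parts for one-dimensional oscillatory integrals. -/
lemma I_mul_oscInt_lineMeasure {ψ ψ' b b' : ℝ → ℝ}
    (hψ : ∀ v ∈ Icc (-4 : ℝ) 4, HasDerivAt ψ (ψ' v) v) (hψ' : ContinuousOn ψ' (Icc (-4) 4))
    (hb : ∀ v ∈ Icc (-4 : ℝ) 4, HasDerivAt b (b' v) v) (hb' : ContinuousOn b' (Icc (-4) 4))
    (h0 : b (-4) = 0) (h1 : b 4 = 0) (τ : ℝ) :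
    Complex.I * τ * oscInt lineMeasure ψ (fun v => b v * ψ' v) τ =
      oscInt lineMeasure ψ b' τ := by
  have hψc : ContinuousOn ψ (Icc (-4) 4) := fun v hv => (hψ v hv).continuousAt.continuousWithinAt
  have hbc : ContinuousOn b (Icc (-4) 4) := fun v hv => (hb v hv).continuousAt.continuousWithinAt
  have hψm : AEStronglyMeasurable ψ lineMeasure := (integrable_lineMeasure hψc).aestronglyMeasurable
  have hi1 := integrable_oscInt_integrand (k := fun v => b v * ψ' v) hψm
    (integrable_lineMeasure (hbc.mul hψ')) τ
  have hi2 := integrable_oscInt_integrand hψm (integrable_lineMeasure hb') τ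
  unfold oscInt
  have key : ∫ v, ((b' v : ℂ) * Complex.exp (-Complex.I * ((τ * ψ v : ℝ) : ℂ)) -
      Complex.I * τ * (((b v * ψ' v : ℝ) : ℂ) *
        Complex.exp (-Complex.I * ((τ * ψ v : ℝ) : ℂ)))) ∂lineMeasure = 0 := by
    unfold lineMeasure
    rw [← intervalIntegral.integral_of_le (by norm_num)]
    rw [intervalIntegral.integral_eq_sub_of_hasDerivAt
      (f := fun v => (b v : ℂ) * Complex.exp (-Complex.I * ((τ * ψ v : ℝ) : ℂ)))]
    · simp [h0, h1]
    · intro v hv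
      rw [uIcc_of_le (by norm_num)] at hv
      have d1 := (hb v hv).ofReal_comp
      have d2 := ((((hψ v hv).const_mul τ).ofReal_comp).const_mul (-Complex.I)).cexp
      refine (d1.mul d2).congr_deriv ?_
      push_cast
      ring
    · rw [intervalIntegrable_iff_integrableOn_Ioc_of_le (by norm_num)]
      exact hi2.sub (hi1.const_mul (Complex.I * τ))
  rw [integral_sub hi2 (hi1.const_mul _), integral_const_mul] at key
  exact (sub_eq_zero.mp key).symm

lemma integral_gaussian_comp_sub_le {N m : ℝ} (hN : 0 < N) (hm : 0 < m) (v : ℝ) :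
    ∫ w : ℝ, Real.exp (-(N ^ 2 / 4) * (m * (v - w)) ^ 2) = 2 * √π / m / N := by
  have h := integral_sub_left_eq_self (fun w : ℝ => Real.exp (-(N ^ 2 / 4 * m ^ 2) * w ^ 2))
    volume v
  rw [integral_gaussian] at h
  have h2 : √(π / (N ^ 2 / 4 * m ^ 2)) = 2 * √π / m / N := by
    rw [Real.sqrt_div Real.pi_pos.le, show N ^ 2 / 4 * m ^ 2 = (N * m / 2) ^ 2 by ring,
      Real.sqrt_sq (by positivity)]
    field_simp
  rw [← h2, ← h]
  congr 1
  ext w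
  congr 1
  ring

lemma integrable_gaussian_comp_sub {N m : ℝ} (hN : 0 < N) (hm : 0 < m) (v : ℝ) :
    Integrable fun w : ℝ => Real.exp (-(N ^ 2 / 4) * (m * (v - w)) ^ 2) := by
  have h := (integrable_exp_neg_mul_sq (b := N ^ 2 / 4 * m ^ 2) (by positivity)).comp_sub_left v
  refine h.congr (Filter.Eventually.of_forall fun w => ?_)
  simp only
  congr 1
  ring

/-- The absolute constant in the basic `L²` estimates. -/
def baseConst : ℝ := 1024 * π * Real.exp 4

lemma baseConst_pos : 0 < baseConst := by unfold baseConst; positivity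

/-- Quantitative assumptions on an edge curve `e` and a direction `(c, s)` that is far from
the edge normal at scale `N`. -/
structure TransversalEdge (K N c s : ℝ) (e : ℝ → ℝ) : Prop where
  one_le_N : 1 ≤ N
  one_le_K : 1 ≤ K
  sq_add_sq : c ^ 2 + s ^ 2 = 1
  contDiff : ContDiff ℝ 2 e
  deriv_le : ∀ v ∈ Icc (-4 : ℝ) 4, |deriv e v| ≤ K / N
  deriv_deriv_le : ∀ v ∈ Icc (-4 : ℝ) 4, |deriv (deriv e) v| ≤ K / N
  large : 2 * K ≤ N * |s|

namespace TransversalEdge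

variable {K N c s : ℝ} {e : ℝ → ℝ} (h : TransversalEdge K N c s e)
include h

lemma N_pos : 0 < N := lt_of_lt_of_le one_pos h.one_le_N

lemma K_pos : 0 < K := lt_of_lt_of_le one_pos h.one_le_K

lemma abs_s_pos : 0 < |s| := by
  have h1 := h.large
  have h2 := h.K_pos
  have h3 := h.N_pos
  by_contra! h4
  nlinarith [mul_nonneg h3.le (sub_nonneg.mpr h4)]

lemma abs_s_le_one : |s| ≤ 1 := by
  rw [← sq_le_one_iff_abs_le_one]
  nlinarith [h.sq_add_sq, sq_nonneg c]

lemma abs_c_le_one : |c| ≤ 1 := by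
  rw [← sq_le_one_iff_abs_le_one]
  nlinarith [h.sq_add_sq, sq_nonneg s]

lemma K_div_N_le : K / N ≤ |s| / 2 := by
  rw [div_le_div_iff₀ h.N_pos two_pos]
  linarith [h.large]

lemma hasDerivAt_e (v : ℝ) : HasDerivAt e (deriv e v) v :=
  (h.contDiff.differentiable (by norm_num) v).hasDerivAt

lemma contDiff_deriv : ContDiff ℝ 1 (deriv e) :=
  (contDiff_succ_iff_deriv.mp (show ContDiff ℝ (1 + 1) e from by simpa using! h.contDiff)).2.2

lemma hasDerivAt_deriv_e (v : ℝ) : HasDerivAt (deriv e) (deriv (deriv e) v) v :=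
  (h.contDiff_deriv.differentiable (by norm_num) v).hasDerivAt

lemma continuous_deriv_deriv : Continuous (deriv (deriv e)) :=
  h.contDiff_deriv.continuous_deriv le_rfl

lemma hasDerivAt_phase (v : ℝ) :
    HasDerivAt (fun v => c * e v + s * v) (c * deriv e v + s) v := by
  simpa using! ((h.hasDerivAt_e v).const_mul c).add ((hasDerivAt_id v).const_mul s)

lemma hasDerivAt_phase' (v : ℝ) :
    HasDerivAt (fun v => c * deriv e v + s) (c * deriv (deriv e) v) v :=
  ((h.hasDerivAt_deriv_e v).const_mul c).add_const s

lemma abs_c_mul_deriv_le {v : ℝ} (hv : v ∈ Icc (-4 : ℝ) 4) : |c * deriv e v| ≤ |s| / 2 := by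
  rw [abs_mul]
  calc |c| * |deriv e v| ≤ 1 * (K / N) :=
        mul_le_mul h.abs_c_le_one (h.deriv_le v hv) (abs_nonneg _) zero_le_one
    _ ≤ |s| / 2 := by linarith [h.K_div_N_le]

lemma abs_c_mul_deriv_deriv_le {v : ℝ} (hv : v ∈ Icc (-4 : ℝ) 4) :
    |c * deriv (deriv e) v| ≤ K / N := by
  rw [abs_mul]
  calc |c| * |deriv (deriv e) v| ≤ 1 * (K / N) :=
        mul_le_mul h.abs_c_le_one (h.deriv_deriv_le v hv) (abs_nonneg _) zero_le_one
    _ = K / N := one_mul _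

lemma le_abs_phase' {v : ℝ} (hv : v ∈ Icc (-4 : ℝ) 4) : |s| / 2 ≤ |c * deriv e v + s| := by
  have h1 := abs_sub_abs_le_abs_sub s (-(c * deriv e v))
  rw [abs_neg, sub_neg_eq_add, add_comm s] at h1
  linarith [h.abs_c_mul_deriv_le hv]

lemma phase'_ne_zero {v : ℝ} (hv : v ∈ Icc (-4 : ℝ) 4) : c * deriv e v + s ≠ 0 := by
  have h1 := h.le_abs_phase' hv
  have h2 := h.abs_s_pos
  intro h3
  rw [h3, abs_zero] at h1
  linarith

lemma le_abs_phase_sub {v w : ℝ} (hv : v ∈ Icc (-4 : ℝ) 4) (hw : w ∈ Icc (-4 : ℝ) 4) :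
    |s| / 2 * |v - w| ≤ |(c * e v + s * v) - (c * e w + s * w)| := by
  have h1 : ‖c * e v - c * e w‖ ≤ |s| / 2 * ‖v - w‖ :=
    (convex_Icc (-4 : ℝ) 4).norm_image_sub_le_of_norm_hasDerivWithin_le
      (f := fun v => c * e v)
      (fun x _ => ((h.hasDerivAt_e x).const_mul c).hasDerivWithinAt)
      (fun x hx => h.abs_c_mul_deriv_le hx) hw hv
  rw [Real.norm_eq_abs, Real.norm_eq_abs] at h1
  have h2 := abs_sub_abs_le_abs_sub (s * (v - w)) (-(c * e v - c * e w))
  rw [abs_neg, abs_mul] at h2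
  rw [show c * e v + s * v - (c * e w + s * w) = s * (v - w) - -(c * e v - c * e w) by ring]
  linarith

lemma continuous_e : Continuous e := h.contDiff.continuous

lemma continuous_deriv_e : Continuous (deriv e) := h.contDiff_deriv.continuous

lemma continuous_phase : Continuous (fun v => c * e v + s * v) := by
  have := h.continuous_e
  fun_prop

lemma continuous_lineInt {a : ℝ → ℝ} (ha : ContinuousOn a (Icc (-4) 4)) :
    Continuous (oscInt lineMeasure (fun v => c * e v + s * v) a) :=
  continuous_oscInt h.continuous_phase.aestronglyMeasurable (integrable_lineMeasure ha)

lemma lineInt_bound {a : ℝ → ℝ} {A : ℝ} (ha : ContinuousOn a (Icc (-4) 4))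
    (hA : ∀ v ∈ Icc (-4 : ℝ) 4, |a v| ≤ A) :
    ∫ τ in freqBand N, ‖oscInt lineMeasure (fun v => c * e v + s * v) a τ‖ ^ 2 ≤
      baseConst * (A ^ 2 / |s|) := by
  have hs := h.abs_s_pos
  refine (setIntegral_norm_oscInt_sq_le (G := 2 * √π / (|s| / 2)) h.N_pos
    h.continuous_phase.measurable (integrable_lineMeasure ha).aestronglyMeasurable
    (ae_lineMeasure hA) (ae_lineMeasure fun v hv => ?_)).trans ?_
  · rw [← integral_gaussian_comp_sub_le h.N_pos (half_pos hs) v]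
    have hgi := integrable_gaussian_comp_sub h.N_pos (half_pos hs) v
    refine le_trans (integral_mono_ae ?_ (hgi.mono_measure Measure.restrict_le_self)
      (ae_lineMeasure fun w hw => ?_))
      (integral_mono_measure Measure.restrict_le_self
        (Filter.Eventually.of_forall fun w => (Real.exp_pos _).le) hgi)
    · refine integrable_lineMeasure (Continuous.continuousOn ?_)
      have := h.continuous_phase
      fun_prop
    · rw [Real.exp_le_exp]
      have h1 := h.le_abs_phase_sub hv hw
      have h2 : (|s| / 2 * (v - w)) ^ 2 ≤ ((c * e v + s * v) - (c * e w + s * w)) ^ 2 := by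
        rw [sq_le_sq, abs_mul, abs_of_pos (half_pos hs)]
        exact h1
      have h3 : 0 ≤ N ^ 2 / 4 := by positivity
      nlinarith [mul_le_mul_of_nonneg_left h2 h3]
  · rw [lineMeasure_real_univ]
    have hpi : √π * √π = π := Real.mul_self_sqrt Real.pi_pos.le
    have e1 : Real.exp 4 * (√π * A ^ 2 * (2 * √π / (|s| / 2) * 8)) =
        32 * (√π * √π) * Real.exp 4 * (A ^ 2 / |s|) := by field_simp; ring
    rw [e1, hpi]
    unfold baseConst
    have : 0 ≤ π * Real.exp 4 * (A ^ 2 / |s|) := by positivity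
    nlinarith

lemma hasDerivAt_div_phase' {a : ℝ → ℝ} {a' v : ℝ} (hv : v ∈ Icc (-4 : ℝ) 4)
    (ha : HasDerivAt a a' v) :
    HasDerivAt (fun v => a v / (c * deriv e v + s))
      (a' / (c * deriv e v + s) - a v * (c * deriv (deriv e) v) / (c * deriv e v + s) ^ 2) v := by
  have h0 := h.phase'_ne_zero hv
  refine (ha.div (h.hasDerivAt_phase' v) h0).congr_deriv ?_
  field_simp

lemma continuousOn_div_phase' {a : ℝ → ℝ} (ha : ContinuousOn a (Icc (-4) 4)) :
    ContinuousOn (fun v => a v / (c * deriv e v + s)) (Icc (-4) 4) := by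
  have := h.continuous_deriv_e
  exact ha.div (by fun_prop) fun v hv => h.phase'_ne_zero hv

lemma continuousOn_mul_div_phase'_sq {a : ℝ → ℝ} (ha : ContinuousOn a (Icc (-4) 4)) :
    ContinuousOn (fun v => a v * (c * deriv (deriv e) v) / (c * deriv e v + s) ^ 2)
      (Icc (-4) 4) := by
  have := h.continuous_deriv_e
  have := h.continuous_deriv_deriv
  exact (ha.mul (by fun_prop)).div (by fun_prop) fun v hv => pow_ne_zero 2 (h.phase'_ne_zero hv)

lemma abs_div_phase'_le {x A v : ℝ} (hv : v ∈ Icc (-4 : ℝ) 4) (hx : |x| ≤ A) :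
    |x / (c * deriv e v + s)| ≤ 2 * A / |s| := by
  have hs := h.abs_s_pos
  rw [abs_div, show 2 * A / |s| = A / (|s| / 2) by field_simp]
  exact div_le_div₀ ((abs_nonneg _).trans hx) hx (half_pos hs) (h.le_abs_phase' hv)

lemma abs_mul_div_phase'_sq_le {x A v : ℝ} (hv : v ∈ Icc (-4 : ℝ) 4) (hx : |x| ≤ A) :
    |x * (c * deriv (deriv e) v) / (c * deriv e v + s) ^ 2| ≤ 4 * A * (K / N) / |s| ^ 2 := by
  have hs := h.abs_s_pos
  have hA : 0 ≤ A := (abs_nonneg _).trans hx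
  have hKN : 0 ≤ K / N := (abs_nonneg _).trans (h.deriv_le v hv)
  rw [abs_div, abs_mul, abs_pow, show 4 * A * (K / N) / |s| ^ 2 = A * (K / N) / (|s| / 2) ^ 2 by
    field_simp; ring]
  exact div_le_div₀ (by positivity)
    (mul_le_mul hx (h.abs_c_mul_deriv_deriv_le hv) (abs_nonneg _) hA) (by positivity)
    (pow_le_pow_left₀ (by positivity) (h.le_abs_phase' hv) 2)

lemma abs_deriv_div_phase'_le {x x' A v : ℝ} (hv : v ∈ Icc (-4 : ℝ) 4) (hx : |x| ≤ A)
    (hx' : |x'| ≤ A) :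
    |x' / (c * deriv e v + s) - x * (c * deriv (deriv e) v) / (c * deriv e v + s) ^ 2| ≤
      4 * A / |s| := by
  have hs := h.abs_s_pos
  have hA : 0 ≤ A := (abs_nonneg _).trans hx
  have h3 : 4 * A * (K / N) / |s| ^ 2 ≤ 4 * A * (|s| / 2) / |s| ^ 2 := by
    exact div_le_div_of_nonneg_right (mul_le_mul_of_nonneg_left h.K_div_N_le (by positivity))
      (by positivity)
  have h4 : 4 * A * (|s| / 2) / |s| ^ 2 = 2 * A / |s| := by field_simp; ring
  have h5 : 4 * A / |s| = 2 * A / |s| + 2 * A / |s| := by ring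
  rw [h5]
  exact (abs_sub _ _).trans (add_le_add (h.abs_div_phase'_le hv hx')
    ((h.abs_mul_div_phase'_sq_le hv hx).trans (h3.trans h4.le)))

lemma I_mul_lineInt {a a' : ℝ → ℝ}
    (ha : ∀ v ∈ Icc (-4 : ℝ) 4, HasDerivAt a (a' v) v) (ha' : ContinuousOn a' (Icc (-4) 4))
    (h0 : a (-4) = 0) (h1 : a 4 = 0) (τ : ℝ) :
    Complex.I * τ * oscInt lineMeasure (fun v => c * e v + s * v) a τ =
      oscInt lineMeasure (fun v => c * e v + s * v) (fun v => a' v / (c * deriv e v + s) -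
        a v * (c * deriv (deriv e) v) / (c * deriv e v + s) ^ 2) τ := by
  have hac : ContinuousOn a (Icc (-4) 4) := fun v hv => (ha v hv).continuousAt.continuousWithinAt
  have hce := h.continuous_deriv_e
  rw [← I_mul_oscInt_lineMeasure (b := fun v => a v / (c * deriv e v + s))
    (fun v _ => h.hasDerivAt_phase v) (by fun_prop)
    (fun v hv => h.hasDerivAt_div_phase' hv (ha v hv))
    ((h.continuousOn_div_phase' ha').sub (h.continuousOn_mul_div_phase'_sq hac))
    (by simp [h0]) (by simp [h1])]
  congr 1
  unfold oscInt
  refine integral_congr_ae (ae_lineMeasure fun v hv => ?_)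
  simp only
  rw [div_mul_cancel₀ _ (h.phase'_ne_zero hv)]

lemma lineInt_bound_one {a a' : ℝ → ℝ} {A : ℝ}
    (ha : ∀ v ∈ Icc (-4 : ℝ) 4, HasDerivAt a (a' v) v) (ha' : ContinuousOn a' (Icc (-4) 4))
    (h0 : a (-4) = 0) (h1 : a 4 = 0)
    (hA : ∀ v ∈ Icc (-4 : ℝ) 4, |a v| ≤ A) (hA' : ∀ v ∈ Icc (-4 : ℝ) 4, |a' v| ≤ A) :
    ∫ τ in freqBand N, ‖oscInt lineMeasure (fun v => c * e v + s * v) a τ‖ ^ 2 ≤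
      64 * baseConst * (A ^ 2 / (N ^ 2 * |s| ^ 3)) := by
  have hs := h.abs_s_pos
  have hN := h.N_pos
  have hac : ContinuousOn a (Icc (-4) 4) := fun v hv => (ha v hv).continuousAt.continuousWithinAt
  have hbc := (h.continuousOn_div_phase' ha').sub (h.continuousOn_mul_div_phase'_sq hac)
  refine (setIntegral_freqBand_le_of_I_mul hN (h.continuous_lineInt hac) (h.continuous_lineInt hbc)
    (h.I_mul_lineInt ha ha' h0 h1)).trans ?_
  refine (mul_le_mul_of_nonneg_left (h.lineInt_bound hbc (A := 4 * A / |s|) fun v hv =>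
    h.abs_deriv_div_phase'_le hv (hA v hv) (hA' v hv)) (by positivity)).trans (le_of_eq ?_)
  field_simp
  ring

lemma lineInt_bound_two {a a₁ a₂ a₁' : ℝ → ℝ} {A : ℝ}
    (ha : ∀ v ∈ Icc (-4 : ℝ) 4, HasDerivAt a (a₁ v + a₂ v) v)
    (ha₁ : ∀ v ∈ Icc (-4 : ℝ) 4, HasDerivAt a₁ (a₁' v) v) (ha₂ : ContinuousOn a₂ (Icc (-4) 4))
    (ha₁' : ContinuousOn a₁' (Icc (-4) 4))
    (h0 : a (-4) = 0) (h1 : a 4 = 0) (h10 : a₁ (-4) = 0) (h11 : a₁ 4 = 0)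
    (hA : ∀ v ∈ Icc (-4 : ℝ) 4, |a v| ≤ A) (hA₁ : ∀ v ∈ Icc (-4 : ℝ) 4, |a₁ v| ≤ A)
    (hA₁' : ∀ v ∈ Icc (-4 : ℝ) 4, |a₁' v| ≤ A)
    (hA₂ : ∀ v ∈ Icc (-4 : ℝ) 4, |a₂ v| ≤ A * (K / N)) :
    ∫ τ in freqBand N, ‖oscInt lineMeasure (fun v => c * e v + s * v) a τ‖ ^ 2 ≤
      8480 * baseConst * K ^ 2 * (A ^ 2 / (N ^ 4 * |s| ^ 5)) := by
  have hs := h.abs_s_pos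
  have hs1 := h.abs_s_le_one
  have hN := h.N_pos
  have hK := h.K_pos
  have hB := baseConst_pos
  have hA0 : 0 ≤ A := (abs_nonneg _).trans (hA 0 (by norm_num))
  have hac : ContinuousOn a (Icc (-4) 4) := fun v hv => (ha v hv).continuousAt.continuousWithinAt
  have ha₁c : ContinuousOn a₁ (Icc (-4) 4) :=
    fun v hv => (ha₁ v hv).continuousAt.continuousWithinAt
  set g₁ : ℝ → ℝ := fun v => a₁ v / (c * deriv e v + s)
  set g₂ : ℝ → ℝ := fun v => a₂ v / (c * deriv e v + s) -
    a v * (c * deriv (deriv e) v) / (c * deriv e v + s) ^ 2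
  have hg₁c : ContinuousOn g₁ (Icc (-4) 4) := h.continuousOn_div_phase' ha₁c
  have hg₂c : ContinuousOn g₂ (Icc (-4) 4) :=
    (h.continuousOn_div_phase' ha₂).sub (h.continuousOn_mul_div_phase'_sq hac)
  have hident : ∀ τ : ℝ, Complex.I * τ * oscInt lineMeasure (fun v => c * e v + s * v) a τ =
      oscInt lineMeasure (fun v => c * e v + s * v) g₁ τ +
      oscInt lineMeasure (fun v => c * e v + s * v) g₂ τ := by
    intro τ
    rw [h.I_mul_lineInt ha (ha₁c.add ha₂) h0 h1, ← oscInt_add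
      h.continuous_phase.aestronglyMeasurable (integrable_lineMeasure hg₁c)
      (integrable_lineMeasure hg₂c)]
    congr 1
    ext v
    simp only [g₁, g₂]
    ring
  have b₁ := h.lineInt_bound_one (a := g₁) (A := 4 * A / |s|)
    (fun v hv => h.hasDerivAt_div_phase' hv (ha₁ v hv))
    ((h.continuousOn_div_phase' ha₁').sub (h.continuousOn_mul_div_phase'_sq ha₁c))
    (by simp [g₁, h10]) (by simp [g₁, h11])
    (fun v hv => (h.abs_div_phase'_le hv (hA₁ v hv)).trans (by gcongr; norm_num))
    (fun v hv => h.abs_deriv_div_phase'_le hv (hA₁ v hv) (hA₁' v hv))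
  have b₂ := h.lineInt_bound hg₂c (A := 6 * A * (K / N) / |s| ^ 2) (by
    intro v hv
    have e1 : 2 * (A * (K / N)) / |s| ≤ 2 * A * (K / N) / |s| ^ 2 := by
      rw [← mul_assoc]
      refine div_le_div_of_nonneg_left (by positivity) (by positivity) ?_
      nlinarith
    have e2 : 6 * A * (K / N) / |s| ^ 2 =
        2 * A * (K / N) / |s| ^ 2 + 4 * A * (K / N) / |s| ^ 2 := by
      ring
    rw [e2]
    exact (abs_sub _ _).trans (add_le_add ((h.abs_div_phase'_le hv (hA₂ v hv)).trans e1)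
      (h.abs_mul_div_phase'_sq_le hv (hA v hv))))
  refine (setIntegral_freqBand_le_of_I_mul hN (h.continuous_lineInt hac)
    ((h.continuous_lineInt hg₁c).add (h.continuous_lineInt hg₂c)) hident).trans ?_
  refine (mul_le_mul_of_nonneg_left ((setIntegral_freqBand_add_le N (h.continuous_lineInt hg₁c)
    (h.continuous_lineInt hg₂c)).trans (add_le_add (mul_le_mul_of_nonneg_left b₁ two_pos.le)
    (mul_le_mul_of_nonneg_left b₂ two_pos.le))) (by positivity)).trans ?_
  have e3 : 4 / N ^ 2 * (2 * (64 * baseConst * ((4 * A / |s|) ^ 2 / (N ^ 2 * |s| ^ 3))) +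
      2 * (baseConst * ((6 * A * (K / N) / |s| ^ 2) ^ 2 / |s|))) =
      (8192 + 288 * K ^ 2) * (baseConst * (A ^ 2 / (N ^ 4 * |s| ^ 5))) := by
    field_simp
    ring
  rw [e3, show 8480 * baseConst * K ^ 2 * (A ^ 2 / (N ^ 4 * |s| ^ 5)) =
    (8480 * K ^ 2) * (baseConst * (A ^ 2 / (N ^ 4 * |s| ^ 5))) by ring]
  refine mul_le_mul_of_nonneg_right ?_ (by positivity)
  nlinarith [h.one_le_K]

end TransversalEdge

/-- The open box `(-4, 4)²`. -/
def openBox : Set (ℝ × ℝ) := Ioo (-4) 4 ×ˢ Ioo (-4) 4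

/-- The partial derivative of a function on `ℝ × ℝ` in the first variable. -/
def dx {F : Type*} [NormedAddCommGroup F] [NormedSpace ℝ F] (g : ℝ × ℝ → F) (y : ℝ × ℝ) : F :=
  fderiv ℝ g y (1, 0)

/-- The partial derivative of a function on `ℝ × ℝ` in the second variable. -/
def dy {F : Type*} [NormedAddCommGroup F] [NormedSpace ℝ F] (g : ℝ × ℝ → F) (y : ℝ × ℝ) : F :=
  fderiv ℝ g y (0, 1)

section PartialDerivatives

variable {F : Type*} [NormedAddCommGroup F] [NormedSpace ℝ F] {g : ℝ × ℝ → F}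

lemma fderiv_apply_eq_dx_dy (y : ℝ × ℝ) (a b : ℝ) :
    fderiv ℝ g y (a, b) = a • dx g y + b • dy g y := by
  unfold dx dy
  rw [← map_smul, ← map_smul, ← map_add]
  simp

lemma continuous_dx (hg : ContDiff ℝ 1 g) : Continuous (dx g) :=
  (hg.continuous_fderiv one_ne_zero).clm_apply continuous_const

lemma continuous_dy (hg : ContDiff ℝ 1 g) : Continuous (dy g) :=
  (hg.continuous_fderiv one_ne_zero).clm_apply continuous_const

lemma tsupport_dx_subset : tsupport (dx g) ⊆ tsupport g := tsupport_fderiv_apply_subset ℝ _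

lemma tsupport_dy_subset : tsupport (dy g) ⊆ tsupport g := tsupport_fderiv_apply_subset ℝ _

lemma eq_zero_of_notMem_openBox {G : Type*} [Zero G] {k : ℝ × ℝ → G}
    (hs : tsupport k ⊆ openBox) {y : ℝ × ℝ} (hy : y ∉ openBox) : k y = 0 :=
  image_eq_zero_of_notMem_tsupport fun h => hy (hs h)

lemma hasCompactSupport_of_tsupport_subset_openBox {G : Type*} [Zero G] {k : ℝ × ℝ → G}
    (hs : tsupport k ⊆ openBox) : HasCompactSupport k := by
  refine HasCompactSupport.intro (isCompact_Icc.prod isCompact_Icc :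
    IsCompact (Icc (-4 : ℝ) 4 ×ˢ Icc (-4 : ℝ) 4)) fun y hy => ?_
  refine eq_zero_of_notMem_openBox hs fun h => hy ?_
  exact ⟨Ioo_subset_Icc_self h.1, Ioo_subset_Icc_self h.2⟩

lemma hasDerivAt_comp_curve (hg : ContDiff ℝ 1 g) {α β : ℝ → ℝ} {α' β' t : ℝ}
    (hα : HasDerivAt α α' t) (hβ : HasDerivAt β β' t) :
    HasDerivAt (fun t => g (α t, β t)) (α' • dx g (α t, β t) + β' • dy g (α t, β t)) t := by
  rw [← fderiv_apply_eq_dx_dy]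
  exact ((hg.differentiable one_ne_zero (α t, β t)).hasFDerivAt).comp_hasDerivAt t (hα.prodMk hβ)

end PartialDerivatives

/-- The shear `(u, v) ↦ (u + e(v), v)`. -/
def shearHomeo {e : ℝ → ℝ} (he : Continuous e) : ℝ × ℝ ≃ₜ ℝ × ℝ where
  toFun z := (z.1 + e z.2, z.2)
  invFun z := (z.1 - e z.2, z.2)
  left_inv z := by simp
  right_inv z := by simp
  continuous_toFun := by fun_prop
  continuous_invFun := by fun_prop

lemma measurePreserving_shearHomeo {e : ℝ → ℝ} (he : Continuous e) :
    MeasurePreserving (shearHomeo he) (volume : Measure (ℝ × ℝ)) volume := by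
  have h1 : MeasurePreserving (fun z : ℝ × ℝ => (z.1, z.2 + e z.1))
      ((volume : Measure ℝ).prod (volume : Measure ℝ)) (volume.prod volume) :=
    (MeasurePreserving.id volume).skew_product (g := fun x y => y + e x)
      (by unfold Function.uncurry; fun_prop)
      (Filter.Eventually.of_forall fun x => (measurePreserving_add_right volume (e x)).map_eq)
  have h2 := (Measure.measurePreserving_swap (μ := (volume : Measure ℝ))
    (ν := (volume : Measure ℝ)))
  exact h2.comp (h1.comp h2)

/-- Lebesgue measure on the part of the box `(-4, 4]²` to the right of the curve
`y₁ = e(y₂)`. -/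
def planeMeasure (e : ℝ → ℝ) : Measure (ℝ × ℝ) :=
  (lineMeasure.prod lineMeasure).restrict {y | e y.2 ≤ y.1}

instance (e : ℝ → ℝ) : IsFiniteMeasure (planeMeasure e) := by
  unfold planeMeasure
  infer_instance

lemma measurableSet_edgeRegion {e : ℝ → ℝ} (he : Continuous e) :
    MeasurableSet {y : ℝ × ℝ | e y.2 ≤ y.1} :=
  (isClosed_le (by fun_prop) (by fun_prop)).measurableSet

section Green

variable {F : Type*} [NormedAddCommGroup F] {e : ℝ → ℝ}

lemma integrable_shear {w : ℝ × ℝ → F} (he : Continuous e) (hwc : Continuous w)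
    (hw : tsupport w ⊆ openBox) :
    Integrable (fun z : ℝ × ℝ => w (z.1 + e z.2, z.2))
      ((volume.restrict (Ioi (0 : ℝ))).prod volume) := by
  have h1 : HasCompactSupport (w ∘ shearHomeo he) :=
    (hasCompactSupport_of_tsupport_subset_openBox hw).comp_homeomorph _
  have h2 : Integrable (w ∘ shearHomeo he) (volume : Measure (ℝ × ℝ)) :=
    (hwc.comp (shearHomeo he).continuous).integrable_of_hasCompactSupport h1
  have h3 : (volume.restrict (Ioi (0 : ℝ))).prod (volume : Measure ℝ) =
      (volume.prod volume).restrict (Ioi 0 ×ˢ univ) := by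
    rw [← Measure.prod_restrict, Measure.restrict_univ]
  rw [h3]
  exact h2.integrableOn

variable [NormedSpace ℝ F]

lemma integral_planeMeasure {w : ℝ × ℝ → F} (he : Continuous e)
    (hw : ∀ y, y ∉ openBox → w y = 0) :
    ∫ y, w y ∂planeMeasure e = ∫ y in {y : ℝ × ℝ | e y.2 ≤ y.1}, w y := by
  have hm := measurableSet_edgeRegion he
  unfold planeMeasure lineMeasure
  rw [Measure.prod_restrict, Measure.restrict_restrict hm, ← Measure.volume_eq_prod]
  refine (setIntegral_eq_of_subset_of_forall_sdiff_eq_zero hm inter_subset_left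
    fun y hy => ?_).symm
  refine hw y fun h => hy.2 ⟨hy.1, Ioo_subset_Ioc_self h.1, Ioo_subset_Ioc_self h.2⟩

lemma integral_planeMeasure_eq_shear {w : ℝ × ℝ → F} (he : Continuous e)
    (hw : ∀ y, y ∉ openBox → w y = 0) :
    ∫ y, w y ∂planeMeasure e =
      ∫ z, w (z.1 + e z.2, z.2) ∂((volume.restrict (Ioi (0 : ℝ))).prod volume) := by
  rw [integral_planeMeasure he hw, ← (measurePreserving_shearHomeo he).setIntegral_preimage_emb
    (shearHomeo he).measurableEmbedding]
  have hpre : shearHomeo he ⁻¹' {y : ℝ × ℝ | e y.2 ≤ y.1} = Ici (0 : ℝ) ×ˢ univ := by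
    ext z
    simp [shearHomeo]
  rw [hpre, Measure.volume_eq_prod, ← Measure.prod_restrict, Measure.restrict_univ,
    ← restrict_Ioi_eq_restrict_Ici]
  rfl

lemma integral_lineMeasure {w : ℝ → F} (hw : ∀ v, v ∉ Ioo (-4 : ℝ) 4 → w v = 0) :
    ∫ v, w v ∂lineMeasure = ∫ v, w v := by
  unfold lineMeasure
  exact setIntegral_eq_integral_of_forall_compl_eq_zero fun v hv =>
    hw v fun h => hv (Ioo_subset_Ioc_self h)

variable [CompleteSpace F] {g : ℝ × ℝ → F}

lemma integral_Ioi_dx (hg : ContDiff ℝ 1 g) (hs : tsupport g ⊆ openBox) (v : ℝ) :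
    ∫ u in Ioi (0 : ℝ), dx g (u + e v, v) = - g (e v, v) := by
  have h1 : ContDiff ℝ 1 (fun u : ℝ => g (u + e v, v)) := hg.comp (by fun_prop)
  have h2 : HasCompactSupport (fun u : ℝ => g (u + e v, v)) := by
    refine HasCompactSupport.intro (isCompact_Icc (a := -4 - e v) (b := 4 - e v)) fun u hu => ?_
    refine eq_zero_of_notMem_openBox hs fun h => hu ?_
    have h3 : -4 < u + e v ∧ u + e v < 4 := h.1
    constructor <;> linarith [h3.1, h3.2]
  have h3 := h2.integral_Ioi_deriv_eq h1 0
  rw [zero_add] at h3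
  rw [← h3]
  congr 1
  ext u
  have h4 := hasDerivAt_comp_curve hg ((hasDerivAt_id u).add_const (e v)) (hasDerivAt_const u v)
  simpa using h4.deriv.symm

lemma integral_planeMeasure_dx (he : Continuous e) (hg : ContDiff ℝ 1 g)
    (hs : tsupport g ⊆ openBox) :
    ∫ y, dx g y ∂planeMeasure e = - ∫ v, g (e v, v) ∂lineMeasure := by
  have hs1 : tsupport (dx g) ⊆ openBox := tsupport_dx_subset.trans hs
  rw [integral_planeMeasure_eq_shear he fun y => eq_zero_of_notMem_openBox hs1,
    integral_prod_symm _ (integrable_shear he (continuous_dx hg) hs1),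
    integral_lineMeasure (fun v hv => eq_zero_of_notMem_openBox hs fun h => hv h.2),
    ← integral_neg]
  congr 1
  ext v
  exact integral_Ioi_dx hg hs v

lemma integral_planeMeasure_dy (he : ContDiff ℝ 1 e) (hg : ContDiff ℝ 1 g)
    (hs : tsupport g ⊆ openBox) :
    ∫ y, dy g y ∂planeMeasure e = ∫ v, deriv e v • g (e v, v) ∂lineMeasure := by
  have hec := he.continuous
  have hec' : Continuous (deriv e) := he.continuous_deriv le_rfl
  have hs1 : tsupport (dx g) ⊆ openBox := tsupport_dx_subset.trans hs
  have hs2 : tsupport (dy g) ⊆ openBox := tsupport_dy_subset.trans hs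
  have hs3 : tsupport (fun y : ℝ × ℝ => deriv e y.2 • dx g y) ⊆ openBox :=
    (tsupport_smul_subset_right _ _).trans hs1
  have hc1 := continuous_dx hg
  have hc2 := continuous_dy hg
  have hi2 := integrable_shear hec hc2 hs2
  have hi3 : Integrable (fun z : ℝ × ℝ => deriv e z.2 • dx g (z.1 + e z.2, z.2))
      ((volume.restrict (Ioi (0 : ℝ))).prod volume) :=
    integrable_shear (w := fun y : ℝ × ℝ => deriv e y.2 • dx g y) hec
    (by fun_prop) hs3
  have hzero : ∫ z : ℝ × ℝ, (deriv e z.2 • dx g (z.1 + e z.2, z.2) + dy g (z.1 + e z.2, z.2))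
      ∂((volume.restrict (Ioi (0 : ℝ))).prod volume) = 0 := by
    refine (integral_prod _ (hi3.add hi2)).trans ?_
    refine integral_eq_zero_of_ae (Filter.Eventually.of_forall fun u => ?_)
    have hcs : ∀ {w : ℝ → F}, (∀ v, v ∉ Ioo (-4 : ℝ) 4 → w v = 0) → HasCompactSupport w :=
      fun hw => HasCompactSupport.intro (isCompact_Icc (a := -4) (b := 4)) fun v hv =>
        hw v fun h => hv (Ioo_subset_Icc_self h)
    refine integral_eq_zero_of_hasDerivAt_of_integrable (f := fun v => g (u + e v, v))
      (fun v => ?_) ?_ ?_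
    · have h4 := hasDerivAt_comp_curve hg
        (((he.differentiable one_ne_zero v).hasDerivAt).const_add u) (hasDerivAt_id v)
      simpa using! h4
    · refine Continuous.integrable_of_hasCompactSupport (by fun_prop) (hcs fun v hv => ?_)
      simp only [Pi.add_apply]
      rw [eq_zero_of_notMem_openBox hs1 fun h => hv h.2,
        eq_zero_of_notMem_openBox hs2 fun h => hv h.2, smul_zero, add_zero]
    · have := hg.continuous
      exact Continuous.integrable_of_hasCompactSupport (by fun_prop)
        (hcs fun v hv => eq_zero_of_notMem_openBox hs fun h => hv h.2)
  have hzero' := (integral_add hi3 hi2).symm.trans hzero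
  rw [integral_prod_symm _ hi3] at hzero'
  rw [integral_planeMeasure_eq_shear hec fun y => eq_zero_of_notMem_openBox hs2,
    eq_neg_of_add_eq_zero_right hzero', integral_lineMeasure (fun v hv => by
      rw [eq_zero_of_notMem_openBox hs fun h => hv h.2, smul_zero]), ← integral_neg]
  congr 1
  ext v
  simp only
  rw [integral_smul, integral_Ioi_dx hg hs v, smul_neg, neg_neg]

end Green

lemma planeMeasure_le_prod (e : ℝ → ℝ) : planeMeasure e ≤ lineMeasure.prod lineMeasure :=
  Measure.restrict_le_self

lemma planeMeasure_real_univ_le (e : ℝ → ℝ) : (planeMeasure e).real univ ≤ 64 := by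
  have h1 : (lineMeasure.prod lineMeasure).real univ = 64 := by
    rw [← univ_prod_univ, measureReal_prod_prod, lineMeasure_real_univ]
    norm_num
  rw [← h1]
  exact ENNReal.toReal_mono (measure_ne_top _ _) (planeMeasure_le_prod e univ)

lemma integrable_planeMeasure {F : Type*} [NormedAddCommGroup F] {e : ℝ → ℝ} {k : ℝ × ℝ → F}
    (hk : Continuous k) (hs : tsupport k ⊆ openBox) : Integrable k (planeMeasure e) :=
  hk.integrable_of_hasCompactSupport (hasCompactSupport_of_tsupport_subset_openBox hs)

/-- The planar oscillatory integral of the amplitude `k` in the direction `(c, s)`. -/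
abbrev planeInt (e : ℝ → ℝ) (c s : ℝ) (k : ℝ × ℝ → ℝ) : ℝ → ℂ :=
  oscInt (planeMeasure e) (fun y => c * y.1 + s * y.2) k

/-- The oscillatory integral along the curve `v ↦ (e(v), v)` in the direction `(c, s)`. -/
abbrev curveInt (e : ℝ → ℝ) (c s : ℝ) (a : ℝ → ℝ) : ℝ → ℂ :=
  oscInt lineMeasure (fun v => c * e v + s * v) a

lemma continuous_planeInt {e : ℝ → ℝ} {k : ℝ × ℝ → ℝ} (c s : ℝ) (hk : Continuous k)
    (hs : tsupport k ⊆ openBox) : Continuous (planeInt e c s k) :=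
  continuous_oscInt (by fun_prop) (integrable_planeMeasure hk hs)

lemma planeInt_add {e : ℝ → ℝ} {k k' : ℝ × ℝ → ℝ} (c s τ : ℝ) (hk : Continuous k)
    (hs : tsupport k ⊆ openBox) (hk' : Continuous k') (hs' : tsupport k' ⊆ openBox) :
    planeInt e c s (fun y => k y + k' y) τ = planeInt e c s k τ + planeInt e c s k' τ :=
  oscInt_add (by fun_prop) (integrable_planeMeasure hk hs) (integrable_planeMeasure hk' hs') τ

section GreenOsc

variable {e : ℝ → ℝ} {k : ℝ × ℝ → ℝ}

lemma contDiff_mul_cexp (hk : ContDiff ℝ 1 k) (c s τ : ℝ) :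
    ContDiff ℝ 1 fun y : ℝ × ℝ =>
      (k y : ℂ) * Complex.exp (-Complex.I * ((τ * (c * y.1 + s * y.2) : ℝ) : ℂ)) := by
  have h1 : ContDiff ℝ 1 fun y : ℝ × ℝ => (k y : ℂ) := Complex.ofRealCLM.contDiff.comp hk
  have h2 : ContDiff ℝ 1 fun y : ℝ × ℝ => ((τ * (c * y.1 + s * y.2) : ℝ) : ℂ) :=
    Complex.ofRealCLM.contDiff.comp
      (show ContDiff ℝ 1 fun y : ℝ × ℝ => τ * (c * y.1 + s * y.2) by fun_prop)
  exact h1.mul (Complex.contDiff_exp.comp (contDiff_const.mul h2))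

lemma fderiv_mul_cexp (hk : ContDiff ℝ 1 k) (c s τ : ℝ) (y z : ℝ × ℝ) :
    fderiv ℝ (fun y : ℝ × ℝ =>
      (k y : ℂ) * Complex.exp (-Complex.I * ((τ * (c * y.1 + s * y.2) : ℝ) : ℂ))) y z =
    (fderiv ℝ k y z : ℂ) * Complex.exp (-Complex.I * ((τ * (c * y.1 + s * y.2) : ℝ) : ℂ)) -
      Complex.I * τ * (c * z.1 + s * z.2) *
        ((k y : ℂ) * Complex.exp (-Complex.I * ((τ * (c * y.1 + s * y.2) : ℝ) : ℂ))) := by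
  have h0 : HasDerivAt (fun t : ℝ => y + t • z) z 0 := by
    simpa using! ((hasDerivAt_id (0 : ℝ)).smul_const z).const_add y
  have hline : ∀ {G : Type} [NormedAddCommGroup G] [NormedSpace ℝ G] {w : ℝ × ℝ → G},
      DifferentiableAt ℝ w y → HasDerivAt (fun t : ℝ => w (y + t • z)) (fderiv ℝ w y z) 0 := by
    intro G _ _ w hw
    have hw' : HasFDerivAt w (fderiv ℝ w y) (y + (0 : ℝ) • z) := by simpa using hw.hasFDerivAt
    exact hw'.comp_hasDerivAt (0 : ℝ) h0
  have h1 := hline ((contDiff_mul_cexp hk c s τ).differentiable one_ne_zero y)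
  have h2 := (hline (hk.differentiable one_ne_zero y)).ofReal_comp
  have h3 : HasDerivAt (fun t : ℝ => τ * (c * (y + t • z).1 + s * (y + t • z).2))
      (τ * (c * z.1 + s * z.2)) 0 := by
    have := (((hasDerivAt_id (0 : ℝ)).mul_const (τ * (c * z.1 + s * z.2))).const_add
      (τ * (c * y.1 + s * y.2)))
    refine (this.congr_of_eventuallyEq (Filter.Eventually.of_forall fun t => ?_)).congr_deriv
      (one_mul _)
    simp only [Prod.fst_add, Prod.snd_add, Prod.smul_fst, Prod.smul_snd, smul_eq_mul, id]
    ring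
  have h4 := h2.mul ((h3.ofReal_comp.const_mul (-Complex.I)).cexp)
  have h5 := h1.unique h4
  rw [h5]
  simp only [zero_smul, add_zero]
  push_cast
  ring

lemma tsupport_mul_cexp_subset (hs : tsupport k ⊆ openBox) (c s τ : ℝ) :
    tsupport (fun y : ℝ × ℝ =>
      (k y : ℂ) * Complex.exp (-Complex.I * ((τ * (c * y.1 + s * y.2) : ℝ) : ℂ))) ⊆ openBox := by
  refine (closure_mono fun y hy => ?_).trans hs
  rw [Function.mem_support] at hy ⊢
  intro h
  simp [h] at hy

lemma integral_dx_mul_cexp (hk : ContDiff ℝ 1 k) (hs : tsupport k ⊆ openBox) (c s τ : ℝ)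
    (z : ℝ × ℝ) :
    ∫ y, fderiv ℝ (fun y : ℝ × ℝ =>
      (k y : ℂ) * Complex.exp (-Complex.I * ((τ * (c * y.1 + s * y.2) : ℝ) : ℂ))) y z
        ∂planeMeasure e =
    planeInt e c s (fun y => fderiv ℝ k y z) τ -
      Complex.I * τ * (c * z.1 + s * z.2) * planeInt e c s k τ := by
  have h1 : Integrable (fun y => fderiv ℝ k y z) (planeMeasure e) :=
    integrable_planeMeasure ((hk.continuous_fderiv one_ne_zero).clm_apply continuous_const)
      ((tsupport_fderiv_apply_subset ℝ _).trans hs)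
  have hp : AEStronglyMeasurable (fun y : ℝ × ℝ => c * y.1 + s * y.2) (planeMeasure e) := by
    fun_prop
  simp_rw [fderiv_mul_cexp hk c s τ]
  rw [integral_sub (integrable_oscInt_integrand hp h1 τ)
    ((integrable_oscInt_integrand hp (integrable_planeMeasure hk.continuous hs) τ).const_mul _),
    integral_const_mul]
  rfl

lemma I_mul_c_mul_planeInt (he : Continuous e) (hk : ContDiff ℝ 1 k) (hs : tsupport k ⊆ openBox)
    (c s τ : ℝ) :
    Complex.I * τ * (c * planeInt e c s k τ) =
      planeInt e c s (dx k) τ + curveInt e c s (fun v => k (e v, v)) τ := by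
  have h1 := integral_planeMeasure_dx he (contDiff_mul_cexp hk c s τ)
    (tsupport_mul_cexp_subset hs c s τ)
  have h2 := integral_dx_mul_cexp (e := e) hk hs c s τ (1, 0)
  have h3 := h2.symm.trans h1
  simp only [Complex.ofReal_one, Complex.ofReal_zero, mul_one, mul_zero, add_zero] at h3
  have h4 : planeInt e c s (dx k) τ - Complex.I * τ * c * planeInt e c s k τ =
      -curveInt e c s (fun v => k (e v, v)) τ := h3
  linear_combination -h4

lemma I_mul_s_mul_planeInt (he : ContDiff ℝ 1 e) (hk : ContDiff ℝ 1 k)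
    (hs : tsupport k ⊆ openBox) (c s τ : ℝ) :
    Complex.I * τ * (s * planeInt e c s k τ) =
      planeInt e c s (dy k) τ - curveInt e c s (fun v => deriv e v * k (e v, v)) τ := by
  have h1 := integral_planeMeasure_dy he (contDiff_mul_cexp hk c s τ)
    (tsupport_mul_cexp_subset hs c s τ)
  have h2 := integral_dx_mul_cexp (e := e) hk hs c s τ (0, 1)
  have h3 := h2.symm.trans h1
  simp only [Complex.ofReal_one, Complex.ofReal_zero, mul_one, mul_zero, zero_add] at h3
  have h4 : planeInt e c s (dy k) τ - Complex.I * τ * s * planeInt e c s k τ =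
      curveInt e c s (fun v => deriv e v * k (e v, v)) τ := by
    refine h3.trans ?_
    unfold curveInt oscInt
    congr 1
    ext v
    rw [Complex.real_smul]
    push_cast
    ring
  linear_combination -h4

/-- For a unit direction, the planar oscillatory integral gains a factor `τ⁻¹`. -/
lemma I_mul_planeInt (he : ContDiff ℝ 1 e) (hk : ContDiff ℝ 1 k) (hs : tsupport k ⊆ openBox)
    {c s : ℝ} (hcs : c ^ 2 + s ^ 2 = 1) (τ : ℝ) :
    Complex.I * τ * planeInt e c s k τ =
      (c * planeInt e c s (dx k) τ + s * planeInt e c s (dy k) τ) +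
        (c * curveInt e c s (fun v => k (e v, v)) τ +
          (-s : ℝ) * curveInt e c s (fun v => deriv e v * k (e v, v)) τ) := by
  have h1 := I_mul_c_mul_planeInt he.continuous hk hs c s τ
  have h2 := I_mul_s_mul_planeInt he hk hs c s τ
  have h3 : (c : ℂ) ^ 2 + (s : ℂ) ^ 2 = 1 := by exact_mod_cast hcs
  push_cast
  linear_combination (c : ℂ) * h1 + (s : ℂ) * h2 -
    Complex.I * τ * planeInt e c s k τ * h3

end GreenOsc

lemma gaussian_prod_lineMeasure_le {N c s : ℝ} (hN : 0 < N) (hs : 0 < |s|) (x : ℝ × ℝ) :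
    ∫ y : ℝ × ℝ, Real.exp (-(N ^ 2 / 4) * ((c * x.1 + s * x.2) - (c * y.1 + s * y.2)) ^ 2)
      ∂(lineMeasure.prod lineMeasure) ≤ 16 * √π / |s| / N := by
  have hgi : Integrable (fun y : ℝ × ℝ =>
      Real.exp (-(N ^ 2 / 4) * ((c * x.1 + s * x.2) - (c * y.1 + s * y.2)) ^ 2))
      (lineMeasure.prod lineMeasure) := by
    refine Integrable.of_bound (by fun_prop) 1 (Filter.Eventually.of_forall fun y => ?_)
    rw [Real.norm_eq_abs, abs_of_pos (Real.exp_pos _), Real.exp_le_one_iff]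
    have : 0 ≤ N ^ 2 / 4 * ((c * x.1 + s * x.2) - (c * y.1 + s * y.2)) ^ 2 := by positivity
    linarith
  rw [integral_prod _ hgi]
  have hin : ∀ u : ℝ, ∫ v : ℝ,
      Real.exp (-(N ^ 2 / 4) * ((c * x.1 + s * x.2) - (c * u + s * v)) ^ 2) ∂lineMeasure ≤
      2 * √π / |s| / N := by
    intro u
    have hs0 : s ≠ 0 := abs_pos.mp hs
    rw [← integral_gaussian_comp_sub_le hN hs (x.2 + c * (x.1 - u) / s)]
    have heq : (fun v : ℝ => Real.exp (-(N ^ 2 / 4) *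
        ((c * x.1 + s * x.2) - (c * u + s * v)) ^ 2)) = fun v : ℝ =>
        Real.exp (-(N ^ 2 / 4) * (|s| * (x.2 + c * (x.1 - u) / s - v)) ^ 2) := by
      ext v
      rw [mul_pow, sq_abs, ← mul_pow]
      congr 3
      field_simp
      ring
    rw [heq]
    exact integral_mono_measure Measure.restrict_le_self
      (Filter.Eventually.of_forall fun w => (Real.exp_pos _).le)
      (integrable_gaussian_comp_sub hN hs _)
  refine (integral_mono hgi.integral_prod_left (integrable_const (2 * √π / |s| / N))
    hin).trans (le_of_eq ?_)
  rw [integral_const, lineMeasure_real_univ, smul_eq_mul]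
  ring

namespace TransversalEdge

variable {K N c s A : ℝ} {e : ℝ → ℝ} (h : TransversalEdge K N c s e)
include h

lemma contDiff_one : ContDiff ℝ 1 e := h.contDiff.of_le (by norm_num)

lemma planeInt_bound {k : ℝ × ℝ → ℝ} (hk : Continuous k) (hA : ∀ y, |k y| ≤ A) :
    ∫ τ in freqBand N, ‖planeInt e c s k τ‖ ^ 2 ≤ baseConst * (A ^ 2 / |s|) := by
  have hs := h.abs_s_pos
  refine (setIntegral_norm_oscInt_sq_le (G := 16 * √π / |s|) h.N_pos
    (by fun_prop) hk.aestronglyMeasurable (Filter.Eventually.of_forall hA)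
    (Filter.Eventually.of_forall fun x => ?_)).trans ?_
  · refine le_trans (integral_mono_measure (planeMeasure_le_prod e)
      (Filter.Eventually.of_forall fun w => (Real.exp_pos _).le) ?_)
      (gaussian_prod_lineMeasure_le (c := c) h.N_pos hs x)
    refine Integrable.of_bound (by fun_prop) 1 (Filter.Eventually.of_forall fun y => ?_)
    rw [Real.norm_eq_abs, abs_of_pos (Real.exp_pos _), Real.exp_le_one_iff]
    have : 0 ≤ N ^ 2 / 4 * ((c * x.1 + s * x.2) - (c * y.1 + s * y.2)) ^ 2 := by positivity
    linarith
  · have hpi : √π * √π = π := Real.mul_self_sqrt Real.pi_pos.le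
    calc Real.exp 4 * (√π * A ^ 2 * (16 * √π / |s| * (planeMeasure e).real univ))
        ≤ Real.exp 4 * (√π * A ^ 2 * (16 * √π / |s| * 64)) := by
          have := planeMeasure_real_univ_le e
          gcongr
      _ = 1024 * (√π * √π) * Real.exp 4 * (A ^ 2 / |s|) := by field_simp; ring
      _ = baseConst * (A ^ 2 / |s|) := by rw [hpi, baseConst]

end TransversalEdge

/-- An amplitude whose second partial derivative equals, up to an error of size `A * κ`, a
bounded function with bounded second partial derivative. -/
structure TwoScaleAmplitude (κ A : ℝ) (k q : ℝ × ℝ → ℝ) : Prop where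
  contDiff : ContDiff ℝ 1 k
  tsupport_subset : tsupport k ⊆ openBox
  contDiff_main : ContDiff ℝ 1 q
  tsupport_main_subset : tsupport q ⊆ openBox
  abs_le : ∀ y, |k y| ≤ A
  abs_dx_le : ∀ y, |dx k y| ≤ A
  abs_main_le : ∀ y, |q y| ≤ A
  abs_dy_main_le : ∀ y, |dy q y| ≤ A
  abs_dy_sub_le : ∀ y, |dy k y - q y| ≤ A * κ

/-- An amplitude that is small together with its second partial derivative. -/
structure SmallAmplitude (B : ℝ) (k : ℝ × ℝ → ℝ) : Prop where
  contDiff : ContDiff ℝ 1 k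
  tsupport_subset : tsupport k ⊆ openBox
  abs_le : ∀ y, |k y| ≤ B
  abs_dy_le : ∀ y, |dy k y| ≤ B

/-- The amplitude `k` of a rescaled edge fragment: both partial derivatives split into a small
part and a two-scale part. -/
structure FragmentAmplitude (κ A : ℝ) (k P₁ Q₁ q₁ P₂ Q₂ q₂ : ℝ × ℝ → ℝ) : Prop where
  contDiff : ContDiff ℝ 1 k
  tsupport_subset : tsupport k ⊆ openBox
  abs_le : ∀ y, |k y| ≤ A
  dx_eq : dx k = fun y => P₁ y + Q₁ y
  dy_eq : dy k = fun y => P₂ y + Q₂ y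
  small_dx : SmallAmplitude (A * κ) P₁
  small_dy : SmallAmplitude (A * κ) P₂
  twoScale_dx : TwoScaleAmplitude κ A Q₁ q₁
  twoScale_dy : TwoScaleAmplitude κ A Q₂ q₂

lemma apply_curve_eq_zero {k : ℝ × ℝ → ℝ} (hs : tsupport k ⊆ openBox) (e : ℝ → ℝ) {v : ℝ}
    (hv : v ∉ Ioo (-4 : ℝ) 4) : k (e v, v) = 0 :=
  eq_zero_of_notMem_openBox hs fun h => hv h.2

namespace TransversalEdge

variable {K N c s A : ℝ} {e : ℝ → ℝ} (h : TransversalEdge K N c s e)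
include h

lemma K_div_N_pos : 0 < K / N := div_pos h.K_pos h.N_pos

lemma K_div_N_le_half : K / N ≤ 1 / 2 := by linarith [h.K_div_N_le, h.abs_s_le_one]

lemma hasDerivAt_curve {k : ℝ × ℝ → ℝ} (hk : ContDiff ℝ 1 k) (v : ℝ) :
    HasDerivAt (fun v => k (e v, v)) (deriv e v * dx k (e v, v) + dy k (e v, v)) v := by
  simpa using! hasDerivAt_comp_curve hk (h.hasDerivAt_e v) (hasDerivAt_id v)

lemma abs_deriv_mul_le {v x : ℝ} (hv : v ∈ Icc (-4 : ℝ) 4) (hx : |x| ≤ A) :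
    |deriv e v * x| ≤ A * (K / N) := by
  rw [abs_mul, mul_comm A]
  exact mul_le_mul (h.deriv_le v hv) hx (abs_nonneg _) h.K_div_N_pos.le

lemma abs_deriv_curve_le {v x y : ℝ} (hv : v ∈ Icc (-4 : ℝ) 4) (hx : |x| ≤ A) (hy : |y| ≤ 2 * A) :
    |deriv e v * x + y| ≤ 3 * A := by
  have h1 := h.abs_deriv_mul_le hv hx
  have hA : 0 ≤ A := (abs_nonneg _).trans hx
  have h2 := mul_le_mul_of_nonneg_left h.K_div_N_le_half hA
  linarith [abs_add_le (deriv e v * x) y]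

lemma curveInt_deriv_mul_bound {k : ℝ × ℝ → ℝ} (hk : ContDiff ℝ 1 k) (hs : tsupport k ⊆ openBox)
    (hA : ∀ y, |k y| ≤ A) (hx : ∀ y, |dx k y| ≤ A) (hy : ∀ y, |dy k y| ≤ 2 * A) :
    ∫ τ in freqBand N, ‖curveInt e c s (fun v => deriv e v * k (e v, v)) τ‖ ^ 2 ≤
      1024 * baseConst * (K ^ 2 * A ^ 2 / (N ^ 4 * |s| ^ 3)) := by
  have hA0 : 0 ≤ A := (abs_nonneg _).trans (hA 0)
  have hKN := h.K_div_N_pos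
  have hs0 := h.abs_s_pos
  have hN := h.N_pos
  have hce := h.continuous_e
  have hce' := h.continuous_deriv_e
  have hce'' := h.continuous_deriv_deriv
  have hck := hk.continuous
  have hcx := continuous_dx hk
  have hcy := continuous_dy hk
  refine (h.lineInt_bound_one (A := 4 * A * (K / N))
    (a := fun v => deriv e v * k (e v, v))
    (a' := fun v => deriv (deriv e) v * k (e v, v) +
      deriv e v * (deriv e v * dx k (e v, v) + dy k (e v, v)))
    (fun v _ => (h.hasDerivAt_deriv_e v).mul (h.hasDerivAt_curve hk v))
    (by fun_prop) ?_ ?_ ?_ ?_).trans (le_of_eq ?_)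
  · rw [apply_curve_eq_zero hs e (v := -4) (by simp), mul_zero]
  · rw [apply_curve_eq_zero hs e (v := 4) (by simp), mul_zero]
  · intro v hv
    have := h.abs_deriv_mul_le hv (hA (e v, v))
    refine this.trans ?_
    nlinarith [mul_nonneg hA0 hKN.le]
  · intro v hv
    have h1 := h.abs_deriv_mul_le hv (h.abs_deriv_curve_le hv (hx (e v, v)) (hy (e v, v)))
    have h2 : |deriv (deriv e) v * k (e v, v)| ≤ A * (K / N) := by
      rw [abs_mul, mul_comm A]
      exact mul_le_mul (h.deriv_deriv_le v hv) (hA _) (abs_nonneg _) hKN.le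
    refine (abs_add_le _ _).trans ?_
    linarith
  · field_simp
    ring

lemma planeInt_bound_one {B : ℝ} {k : ℝ × ℝ → ℝ} (hk : SmallAmplitude B k) :
    ∫ τ in freqBand N, ‖planeInt e c s k τ‖ ^ 2 ≤
      16 * baseConst * (B ^ 2 / (N ^ 2 * |s| ^ 3)) := by
  have hB : 0 ≤ B := (abs_nonneg _).trans (hk.abs_le 0)
  have hs := h.abs_s_pos
  have hN := h.N_pos
  have hb := baseConst_pos
  have hce := h.continuous_e
  have hce' := h.continuous_deriv_e
  have hck := hk.contDiff.continuous
  have hsy : tsupport (dy k) ⊆ openBox := tsupport_dy_subset.trans hk.tsupport_subset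
  have hcJ := continuous_planeInt (e := e) c s hck hk.tsupport_subset
  have hcJ' := continuous_planeInt (e := e) c s (continuous_dy hk.contDiff) hsy
  have hcL : Continuous (curveInt e c s fun v => deriv e v * k (e v, v)) :=
    h.continuous_lineInt (by fun_prop)
  have h1 := setIntegral_freqBand_le_of_I_mul (F := fun τ => (s : ℂ) * planeInt e c s k τ)
    (G := fun τ => planeInt e c s (dy k) τ +
      (-1 : ℂ) * curveInt e c s (fun v => deriv e v * k (e v, v)) τ) hN
    (by fun_prop) (by fun_prop) fun τ => by
      rw [I_mul_s_mul_planeInt h.contDiff_one hk.contDiff hk.tsupport_subset]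
      ring
  have h2 := setIntegral_freqBand_add_le N hcJ' (hcL.const_mul (-1 : ℂ))
  rw [setIntegral_freqBand_const_mul] at h1 h2
  have h3 := h.planeInt_bound (continuous_dy hk.contDiff) hk.abs_dy_le
  have h4 := h.lineInt_bound (A := B) (a := fun v => deriv e v * k (e v, v)) (by fun_prop)
    fun v hv => by
      have e1 := h.abs_deriv_mul_le hv (hk.abs_le (e v, v))
      nlinarith [h.K_div_N_le_half]
  rw [Complex.norm_real, Real.norm_eq_abs] at h1
  rw [norm_neg, norm_one, one_pow, one_mul] at h2
  have h5 : |s| ^ 2 * ∫ τ in freqBand N, ‖planeInt e c s k τ‖ ^ 2 ≤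
      4 / N ^ 2 * (4 * (baseConst * (B ^ 2 / |s|))) := by
    refine h1.trans (mul_le_mul_of_nonneg_left (h2.trans ?_) (by positivity))
    linarith
  rw [← mul_le_mul_iff_right₀ (pow_pos hs 2)]
  refine h5.trans (le_of_eq ?_)
  field_simp
  ring

lemma planeInt_bound_two {k q : ℝ × ℝ → ℝ} (hk : TwoScaleAmplitude (K / N) A k q) :
    ∫ τ in freqBand N, ‖planeInt e c s k τ‖ ^ 2 ≤
      8464 * (baseConst * (K ^ 2 * A ^ 2 / (N ^ 4 * |s| ^ 5))) := by
  have hA : 0 ≤ A := (abs_nonneg _).trans (hk.abs_le 0)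
  have hs := h.abs_s_pos
  have hs1 := h.abs_s_le_one
  have hN := h.N_pos
  have hN1 := h.one_le_N
  have hK1 := h.one_le_K
  have hb := baseConst_pos
  have hce := h.continuous_e
  have hce' := h.continuous_deriv_e
  have hck := hk.contDiff.continuous
  have hcq := hk.contDiff_main.continuous
  have hcy := continuous_dy hk.contDiff
  have hcp : Continuous fun y => dy k y - q y := hcy.sub hcq
  have hsp : tsupport (fun y => dy k y - q y) ⊆ openBox :=
    (tsupport_sub _ _).trans (union_subset (tsupport_dy_subset.trans hk.tsupport_subset)
      hk.tsupport_main_subset)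
  have hcJ := continuous_planeInt (e := e) c s hck hk.tsupport_subset
  have hcJ1 := continuous_planeInt (e := e) c s hcq hk.tsupport_main_subset
  have hcJ2 := continuous_planeInt (e := e) c s hcp hsp
  have hcL : Continuous (curveInt e c s fun v => deriv e v * k (e v, v)) :=
    h.continuous_lineInt (by fun_prop)
  have hsplit : ∀ τ, planeInt e c s (dy k) τ =
      planeInt e c s q τ + planeInt e c s (fun y => dy k y - q y) τ := fun τ => by
    rw [← planeInt_add c s τ hcq hk.tsupport_main_subset hcp hsp]
    congr 1
    ext y
    ring
  have h1 := setIntegral_freqBand_le_of_I_mul (F := fun τ => (s : ℂ) * planeInt e c s k τ)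
    (G := fun τ => (planeInt e c s q τ + planeInt e c s (fun y => dy k y - q y) τ) +
      (-1 : ℂ) * curveInt e c s (fun v => deriv e v * k (e v, v)) τ) hN
    (by fun_prop) (by fun_prop) fun τ => by
      rw [I_mul_s_mul_planeInt h.contDiff_one hk.contDiff hk.tsupport_subset, hsplit]
      ring
  have h2 := setIntegral_freqBand_add_le N (hcJ1.add hcJ2) (hcL.const_mul (-1 : ℂ))
  have h2' := setIntegral_freqBand_add_le N hcJ1 hcJ2
  simp only [Pi.add_apply] at h2
  rw [setIntegral_freqBand_const_mul] at h1 h2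
  have hdy : ∀ y, |dy k y| ≤ 2 * A := fun y => by
    have e1 := abs_add_le (dy k y - q y) (q y)
    rw [sub_add_cancel] at e1
    nlinarith [hk.abs_dy_sub_le y, hk.abs_main_le y, h.K_div_N_le_half]
  have h3 := h.planeInt_bound_one ⟨hk.contDiff_main, hk.tsupport_main_subset, hk.abs_main_le,
    hk.abs_dy_main_le⟩
  have h4 := h.planeInt_bound hcp hk.abs_dy_sub_le
  have h5 := h.curveInt_deriv_mul_bound hk.contDiff hk.tsupport_subset hk.abs_le hk.abs_dx_le hdy
  rw [Complex.norm_real, Real.norm_eq_abs] at h1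
  rw [norm_neg, norm_one, one_pow, one_mul] at h2
  set U := baseConst * (K ^ 2 * A ^ 2 / (N ^ 2 * |s| ^ 3)) with hU
  have e3 : 16 * baseConst * (A ^ 2 / (N ^ 2 * |s| ^ 3)) ≤ 16 * U := by
    rw [hU, mul_assoc]
    gcongr
    nlinarith [sq_nonneg A, one_le_pow₀ (n := 2) hK1]
  have e4 : baseConst * ((A * (K / N)) ^ 2 / |s|) ≤ U := by
    rw [hU, show (A * (K / N)) ^ 2 / |s| = K ^ 2 * A ^ 2 / (N ^ 2 * |s| ^ 1) by field_simp]
    gcongr baseConst * (K ^ 2 * A ^ 2 / (N ^ 2 * ?_))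
    exact pow_le_pow_of_le_one hs.le hs1 (by norm_num)
  have e5 : 1024 * baseConst * (K ^ 2 * A ^ 2 / (N ^ 4 * |s| ^ 3)) ≤ 1024 * U := by
    rw [hU, mul_assoc]
    gcongr
    norm_num
  have h6 : |s| ^ 2 * ∫ τ in freqBand N, ‖planeInt e c s k τ‖ ^ 2 ≤ 4 / N ^ 2 * (2116 * U) := by
    refine h1.trans (mul_le_mul_of_nonneg_left (h2.trans ?_) (by positivity))
    linarith
  rw [← mul_le_mul_iff_right₀ (pow_pos hs 2)]
  refine h6.trans (le_of_eq ?_)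
  rw [hU]
  field_simp
  ring

lemma curveInt_bound {κ : ℝ} {k P₁ Q₁ q₁ P₂ Q₂ q₂ : ℝ × ℝ → ℝ} (hκ : κ = K / N)
    (hk : FragmentAmplitude κ A k P₁ Q₁ q₁ P₂ Q₂ q₂) :
    ∫ τ in freqBand N, ‖curveInt e c s (fun v => k (e v, v)) τ‖ ^ 2 ≤
      76320 * (baseConst * (K ^ 2 * A ^ 2 / (N ^ 4 * |s| ^ 5))) := by
  subst hκ
  have hA : 0 ≤ A := (abs_nonneg _).trans (hk.abs_le 0)
  have hce := h.continuous_e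
  have hce' := h.continuous_deriv_e
  have hκ := h.K_div_N_le_half
  have hQ := hk.twoScale_dy
  have hcP := hk.small_dy.contDiff.continuous
  have hcx := continuous_dx hk.contDiff
  have hcQx := continuous_dx hQ.contDiff
  have hcQy := continuous_dy hQ.contDiff
  have hdx : ∀ y, |dx k y| ≤ 2 * A := fun y => by
    rw [hk.dx_eq]
    refine (abs_add_le _ _).trans ?_
    nlinarith [hk.small_dx.abs_le y, hk.twoScale_dx.abs_le y]
  have hdQ : ∀ y, |dy Q₂ y| ≤ 2 * A := fun y => by
    have e1 := abs_add_le (dy Q₂ y - q₂ y) (q₂ y)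
    rw [sub_add_cancel] at e1
    nlinarith [hQ.abs_dy_sub_le y, hQ.abs_main_le y]
  refine (h.lineInt_bound_two (A := 3 * A) (a := fun v => k (e v, v))
    (a₁ := fun v => Q₂ (e v, v)) (a₂ := fun v => deriv e v * dx k (e v, v) + P₂ (e v, v))
    (a₁' := fun v => deriv e v * dx Q₂ (e v, v) + dy Q₂ (e v, v))
    (fun v _ => (h.hasDerivAt_curve hk.contDiff v).congr_deriv ?_)
    (fun v _ => h.hasDerivAt_curve hQ.contDiff v) (by fun_prop) (by fun_prop)
    (apply_curve_eq_zero hk.tsupport_subset e (by simp))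
    (apply_curve_eq_zero hk.tsupport_subset e (by simp))
    (apply_curve_eq_zero hQ.tsupport_subset e (by simp))
    (apply_curve_eq_zero hQ.tsupport_subset e (by simp))
    (fun v _ => (hk.abs_le _).trans (by linarith))
    (fun v _ => (hQ.abs_le _).trans (by linarith))
    (fun v hv => h.abs_deriv_curve_le hv (hQ.abs_dx_le _) (hdQ _)) ?_).trans (le_of_eq ?_)
  · rw [hk.dy_eq]
    ring
  · intro v hv
    have h1 := h.abs_deriv_mul_le hv (hdx (e v, v))
    refine (abs_add_le _ _).trans ?_
    linarith [hk.small_dy.abs_le (e v, v)]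
  · ring

lemma planeInt_add_bound {P Q q : ℝ × ℝ → ℝ} (hP : SmallAmplitude (A * (K / N)) P)
    (hQ : TwoScaleAmplitude (K / N) A Q q) :
    ∫ τ in freqBand N, ‖planeInt e c s (fun y => P y + Q y) τ‖ ^ 2 ≤
      16960 * (baseConst * (K ^ 2 * A ^ 2 / (N ^ 4 * |s| ^ 5))) := by
  have hs := h.abs_s_pos
  have hs1 := h.abs_s_le_one
  have hN := h.N_pos
  have hb := baseConst_pos
  have hcP := hP.contDiff.continuous
  have hcQ := hQ.contDiff.continuous
  have h1 := setIntegral_freqBand_add_le N (continuous_planeInt (e := e) c s hcP hP.tsupport_subset)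
    (continuous_planeInt (e := e) c s hcQ hQ.tsupport_subset)
  simp only [← planeInt_add c s _ hcP hP.tsupport_subset hcQ hQ.tsupport_subset] at h1
  have h2 := h.planeInt_bound_one hP
  have h3 := h.planeInt_bound_two hQ
  have h4 : 16 * baseConst * ((A * (K / N)) ^ 2 / (N ^ 2 * |s| ^ 3)) ≤
      16 * (baseConst * (K ^ 2 * A ^ 2 / (N ^ 4 * |s| ^ 5))) := by
    rw [mul_assoc, show (A * (K / N)) ^ 2 / (N ^ 2 * |s| ^ 3) =
      K ^ 2 * A ^ 2 / (N ^ 4 * |s| ^ 3) by field_simp]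
    gcongr 16 * (baseConst * (K ^ 2 * A ^ 2 / (N ^ 4 * ?_)))
    exact pow_le_pow_of_le_one hs.le hs1 (by norm_num)
  linarith

/-- Decay of the oscillatory integral of a rescaled edge fragment away from the normal
direction of the edge. -/
lemma fragment_bound {κ : ℝ} {k P₁ Q₁ q₁ P₂ Q₂ q₂ : ℝ × ℝ → ℝ} (hκ : κ = K / N)
    (hk : FragmentAmplitude κ A k P₁ Q₁ q₁ P₂ Q₂ q₂) :
    ∫ τ in freqBand N, ‖planeInt e c s k τ‖ ^ 2 ≤
      2000000 * (baseConst * (K ^ 2 * A ^ 2 / (N ^ 6 * |s| ^ 5))) := by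
  have hL := h.curveInt_bound hκ hk
  subst hκ
  have hA : 0 ≤ A := (abs_nonneg _).trans (hk.abs_le 0)
  have hs := h.abs_s_pos
  have hs1 := h.abs_s_le_one
  have hc1 := h.abs_c_le_one
  have hN := h.N_pos
  have hb := baseConst_pos
  have hκ := h.K_div_N_le_half
  have hce := h.continuous_e
  have hce' := h.continuous_deriv_e
  have hck := hk.contDiff.continuous
  have hcx := continuous_planeInt (e := e) c s (continuous_dx hk.contDiff)
    (tsupport_dx_subset.trans hk.tsupport_subset)
  have hcy := continuous_planeInt (e := e) c s (continuous_dy hk.contDiff)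
    (tsupport_dy_subset.trans hk.tsupport_subset)
  have hcJ := continuous_planeInt (e := e) c s hck hk.tsupport_subset
  have hcL : Continuous (curveInt e c s fun v => k (e v, v)) := h.continuous_lineInt (by fun_prop)
  have hcL' : Continuous (curveInt e c s fun v => deriv e v * k (e v, v)) :=
    h.continuous_lineInt (by fun_prop)
  have hL' := h.curveInt_deriv_mul_bound (A := 2 * A) hk.contDiff hk.tsupport_subset
    (fun y => (hk.abs_le y).trans (by linarith))
    (fun y => by
      rw [hk.dx_eq]
      refine (abs_add_le _ _).trans ?_
      nlinarith [hk.small_dx.abs_le y, hk.twoScale_dx.abs_le y])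
    (fun y => by
      rw [hk.dy_eq]
      refine (abs_add_le _ _).trans ?_
      nlinarith [hk.small_dy.abs_le y, hk.twoScale_dy.abs_le y])
  have hX := h.planeInt_add_bound hk.small_dx hk.twoScale_dx
  have hY := h.planeInt_add_bound hk.small_dy hk.twoScale_dy
  rw [← hk.dx_eq] at hX
  rw [← hk.dy_eq] at hY
  have h1 := setIntegral_freqBand_le_of_I_mul hN hcJ (by fun_prop)
    (I_mul_planeInt (k := k) h.contDiff_one hk.contDiff hk.tsupport_subset h.sq_add_sq)
  have h2 := setIntegral_freqBand_add_le N ((hcx.const_mul (c : ℂ)).add (hcy.const_mul (s : ℂ)))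
    ((hcL.const_mul (c : ℂ)).add (hcL'.const_mul ((-s : ℝ) : ℂ)))
  have h3 := setIntegral_freqBand_add_le N (hcx.const_mul (c : ℂ)) (hcy.const_mul (s : ℂ))
  have h4 := setIntegral_freqBand_add_le N (hcL.const_mul (c : ℂ))
    (hcL'.const_mul ((-s : ℝ) : ℂ))
  simp only [Pi.add_apply] at h2
  have hconst : ∀ {a : ℝ} {F : ℝ → ℂ}, |a| ≤ 1 →
      ∫ τ in freqBand N, ‖(a : ℂ) * F τ‖ ^ 2 ≤ ∫ τ in freqBand N, ‖F τ‖ ^ 2 := by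
    intro a F ha
    rw [setIntegral_freqBand_const_mul, Complex.norm_real, Real.norm_eq_abs]
    exact mul_le_of_le_one_left (integral_nonneg fun τ => by positivity)
      (pow_le_one₀ (abs_nonneg _) ha)
  have e1 := hconst (F := planeInt e c s (dx k)) hc1
  have e2 := hconst (F := planeInt e c s (dy k)) hs1
  have e3 := hconst (F := curveInt e c s fun v => k (e v, v)) hc1
  have e4 := hconst (a := -s) (F := curveInt e c s fun v => deriv e v * k (e v, v))
    (by rwa [abs_neg])
  have h5 : 1024 * baseConst * (K ^ 2 * (2 * A) ^ 2 / (N ^ 4 * |s| ^ 3)) ≤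
      4096 * (baseConst * (K ^ 2 * A ^ 2 / (N ^ 4 * |s| ^ 5))) := by
    rw [show 1024 * baseConst * (K ^ 2 * (2 * A) ^ 2 / (N ^ 4 * |s| ^ 3)) =
      4096 * (baseConst * (K ^ 2 * A ^ 2 / (N ^ 4 * |s| ^ 3))) by ring]
    gcongr 4096 * (baseConst * (K ^ 2 * A ^ 2 / (N ^ 4 * ?_)))
    exact pow_le_pow_of_le_one hs.le hs1 (by norm_num)
  have h6 : 4 / N ^ 2 * (500000 * (baseConst * (K ^ 2 * A ^ 2 / (N ^ 4 * |s| ^ 5)))) =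
      2000000 * (baseConst * (K ^ 2 * A ^ 2 / (N ^ 6 * |s| ^ 5))) := by
    field_simp
    ring
  rw [← h6]
  refine h1.trans (mul_le_mul_of_nonneg_left (h2.trans ?_) (by positivity))
  have h7 : 0 ≤ baseConst * (K ^ 2 * A ^ 2 / (N ^ 4 * |s| ^ 5)) := by positivity
  linarith

end TransversalEdge

lemma setIntegral_freqBand_le_of_norm_le {F : ℝ → ℂ} {N B : ℝ} (hN : 0 ≤ N) (hF : ∀ τ, ‖F τ‖ ≤ B) :
    ∫ τ in freqBand N, ‖F τ‖ ^ 2 ≤ 4 * N * B ^ 2 := by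
  have hsub : volume.real (freqBand N) ≤ 4 * N := by
    refine (measureReal_mono (freqBand_subset N) (by simp)).trans (le_of_eq ?_)
    rw [Real.volume_real_Icc_of_le (by linarith)]
    ring
  have h1 := norm_setIntegral_le_of_norm_le_const (μ := volume) (s := freqBand N)
    (f := fun τ => ‖F τ‖ ^ 2) (C := B ^ 2)
    ((measure_mono (freqBand_subset N)).trans_lt (by simp)) fun τ _ => by
      rw [norm_pow, norm_norm]
      exact pow_le_pow_left₀ (norm_nonneg _) (hF τ) 2
  refine (le_abs_self _).trans (h1.trans ?_)
  rw [mul_comm]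
  exact mul_le_mul_of_nonneg_right hsub (sq_nonneg B)

/-- A bound for the oscillatory integral of a rescaled edge fragment, valid in every
direction. -/
lemma FragmentAmplitude.trivial_bound {K N A c s : ℝ} {e : ℝ → ℝ}
    {k P₁ Q₁ q₁ P₂ Q₂ q₂ : ℝ × ℝ → ℝ} (hN : 1 ≤ N) (hK : 1 ≤ K) (hcs : c ^ 2 + s ^ 2 = 1)
    (he : ContDiff ℝ 2 e) (he' : ∀ v ∈ Icc (-4 : ℝ) 4, |deriv e v| ≤ K / N)
    (hk : FragmentAmplitude (K / N) A k P₁ Q₁ q₁ P₂ Q₂ q₂) :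
    ∫ τ in freqBand N, ‖planeInt e c s k τ‖ ^ 2 ≤ 1183744 * (K ^ 2 * A ^ 2 / N) := by
  have hA : 0 ≤ A := (abs_nonneg _).trans (hk.abs_le 0)
  have hN0 : 0 < N := by linarith
  have he1 : ContDiff ℝ 1 e := he.of_le (by norm_num)
  have hKN : K / N ≤ K := div_le_self (by linarith) hN
  have hs1 : |s| ≤ 1 := by
    rw [← sq_le_one_iff_abs_le_one]
    nlinarith [sq_nonneg c]
  have hc1 : |c| ≤ 1 := by
    rw [← sq_le_one_iff_abs_le_one]
    nlinarith [sq_nonneg s]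
  have hAK : 0 ≤ A * K := by positivity
  have hpart : ∀ {P Q q : ℝ × ℝ → ℝ}, SmallAmplitude (A * (K / N)) P →
      TwoScaleAmplitude (K / N) A Q q → ∀ y, |P y + Q y| ≤ 2 * (A * K) := by
    intro P Q q hP hQ y
    refine (abs_add_le _ _).trans ?_
    nlinarith [hP.abs_le y, hQ.abs_le y]
  have hplane : ∀ {w : ℝ × ℝ → ℝ} (τ : ℝ), (∀ y, |w y| ≤ 2 * (A * K)) →
      ‖planeInt e c s w τ‖ ≤ 128 * (A * K) := by
    intro w τ hw
    refine (norm_oscInt_le (Filter.Eventually.of_forall hw) τ).trans ?_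
    nlinarith [planeMeasure_real_univ_le e]
  have hcurve : ∀ {a : ℝ → ℝ} (τ : ℝ), (∀ v ∈ Icc (-4 : ℝ) 4, |a v| ≤ A * K) →
      ‖curveInt e c s a τ‖ ≤ 8 * (A * K) := by
    intro a τ ha
    refine (norm_oscInt_le (ae_lineMeasure ha) τ).trans (le_of_eq ?_)
    rw [lineMeasure_real_univ]
    ring
  have hmul : ∀ {a B : ℝ} {z : ℂ}, |a| ≤ 1 → ‖z‖ ≤ B → ‖(a : ℂ) * z‖ ≤ B := by
    intro a B z ha hz
    rw [norm_mul, Complex.norm_real, Real.norm_eq_abs]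
    nlinarith [norm_nonneg z]
  have hck := hk.contDiff.continuous
  have hce := he.continuous
  have hce' : Continuous (deriv e) := he1.continuous_deriv le_rfl
  have hcx := continuous_planeInt (e := e) c s (continuous_dx hk.contDiff)
    (tsupport_dx_subset.trans hk.tsupport_subset)
  have hcy := continuous_planeInt (e := e) c s (continuous_dy hk.contDiff)
    (tsupport_dy_subset.trans hk.tsupport_subset)
  have hcJ := continuous_planeInt (e := e) c s hck hk.tsupport_subset
  have hcL : ∀ {a : ℝ → ℝ}, Continuous a → Continuous (curveInt e c s a) := fun ha =>
    continuous_oscInt (by fun_prop) (integrable_lineMeasure ha.continuousOn)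
  have hcL1 := hcL (a := fun v => k (e v, v)) (by fun_prop)
  have hcL2 := hcL (a := fun v => deriv e v * k (e v, v)) (by fun_prop)
  refine (setIntegral_freqBand_le_of_I_mul hN0 hcJ (by fun_prop)
    (I_mul_planeInt (k := k) he1 hk.contDiff hk.tsupport_subset hcs)).trans ?_
  refine (mul_le_mul_of_nonneg_left (setIntegral_freqBand_le_of_norm_le (B := 272 * (A * K))
    hN0.le fun τ => ?_) (by positivity)).trans (le_of_eq ?_)
  · have h1 := hmul hc1 (hplane (w := dx k) τ (by
      rw [hk.dx_eq]
      exact hpart hk.small_dx hk.twoScale_dx))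
    have h2 := hmul hs1 (hplane (w := dy k) τ (by
      rw [hk.dy_eq]
      exact hpart hk.small_dy hk.twoScale_dy))
    have h3 := hmul hc1 (hcurve (a := fun v => k (e v, v)) τ fun v _ =>
      (hk.abs_le _).trans (by nlinarith))
    have h4 := hmul (a := -s) (by rwa [abs_neg])
      (hcurve (a := fun v => deriv e v * k (e v, v)) τ fun v hv => by
        rw [abs_mul, mul_comm A]
        exact mul_le_mul ((he' v hv).trans hKN) (hk.abs_le _) (abs_nonneg _) (by linarith))
    refine (norm_add_le _ _).trans ?_
    linarith [norm_add_le ((c : ℂ) * planeInt e c s (dx k) τ) ((s : ℂ) * planeInt e c s (dy k) τ),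
      norm_add_le ((c : ℂ) * curveInt e c s (fun v => k (e v, v)) τ)
        (((-s : ℝ) : ℂ) * curveInt e c s (fun v => deriv e v * k (e v, v)) τ)]
  · field_simp
    ring

/-- The oscillatory integral of a rescaled edge fragment in an arbitrary direction. -/
lemma FragmentAmplitude.bound {K N A c s : ℝ} {e : ℝ → ℝ}
    {k P₁ Q₁ q₁ P₂ Q₂ q₂ : ℝ × ℝ → ℝ} (hN : 1 ≤ N) (hK : 1 ≤ K) (hcs : c ^ 2 + s ^ 2 = 1)
    (he : ContDiff ℝ 2 e) (he' : ∀ v ∈ Icc (-4 : ℝ) 4, |deriv e v| ≤ K / N)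
    (he'' : ∀ v ∈ Icc (-4 : ℝ) 4, |deriv (deriv e) v| ≤ K / N)
    (hk : FragmentAmplitude (K / N) A k P₁ Q₁ q₁ P₂ Q₂ q₂) :
    ∫ τ in freqBand N, ‖planeInt e c s k τ‖ ^ 2 ≤
      (64000000 * baseConst + 287649792) * (K ^ 7 * A ^ 2) / (N * (1 + N * |s|) ^ 5) := by
  have hN0 : 0 < N := by linarith
  have hb := baseConst_pos
  have hK0 : 0 < K := by linarith
  have hD : 0 < 1 + N * |s| := by positivity
  have hK7 : K ^ 2 * A ^ 2 ≤ K ^ 7 * A ^ 2 :=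
    mul_le_mul_of_nonneg_right (pow_le_pow_right₀ hK (by norm_num)) (sq_nonneg A)
  by_cases hlarge : 2 * K ≤ N * |s|
  · have h : TransversalEdge K N c s e := ⟨hN, hK, hcs, he, he', he'', hlarge⟩
    have hs := h.abs_s_pos
    refine (h.fragment_bound rfl hk).trans ?_
    have h1 : (1 + N * |s|) ^ 5 ≤ 32 * (N * |s|) ^ 5 := by
      rw [show 32 * (N * |s|) ^ 5 = (2 * (N * |s|)) ^ 5 by ring]
      exact pow_le_pow_left₀ hD.le (by linarith) 5
    rw [le_div_iff₀ (by positivity)]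
    calc 2000000 * (baseConst * (K ^ 2 * A ^ 2 / (N ^ 6 * |s| ^ 5))) * (N * (1 + N * |s|) ^ 5)
        ≤ 2000000 * (baseConst * (K ^ 7 * A ^ 2 / (N ^ 6 * |s| ^ 5))) *
          (N * (32 * (N * |s|) ^ 5)) := by gcongr
      _ = 64000000 * baseConst * (K ^ 7 * A ^ 2) := by
          field_simp
          ring
      _ ≤ _ := by
          gcongr
          linarith
  · refine (hk.trivial_bound hN hK hcs he he').trans ?_
    have h1 : (1 + N * |s|) ^ 5 ≤ (3 * K) ^ 5 := by
      push Not at hlarge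
      exact pow_le_pow_left₀ hD.le (by linarith) 5
    rw [le_div_iff₀ (by positivity)]
    calc 1183744 * (K ^ 2 * A ^ 2 / N) * (N * (1 + N * |s|) ^ 5)
        ≤ 1183744 * (K ^ 2 * A ^ 2 / N) * (N * (3 * K) ^ 5) := by gcongr
      _ = 287649792 * (K ^ 7 * A ^ 2) := by
          field_simp
          ring
      _ ≤ _ := by
          gcongr
          have := hb
          linarith

lemma contDiff_dx {F : Type*} [NormedAddCommGroup F] [NormedSpace ℝ F] {g : ℝ × ℝ → F}
    {m n : WithTop ℕ∞} (hg : ContDiff ℝ n g) (hmn : m + 1 ≤ n) : ContDiff ℝ m (dx g) :=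
  (hg.fderiv_right hmn).clm_apply contDiff_const

lemma contDiff_dy {F : Type*} [NormedAddCommGroup F] [NormedSpace ℝ F] {g : ℝ × ℝ → F}
    {m n : WithTop ℕ∞} (hg : ContDiff ℝ n g) (hmn : m + 1 ≤ n) : ContDiff ℝ m (dy g) :=
  (hg.fderiv_right hmn).clm_apply contDiff_const

/-- A `C¹` function bounded by `M` together with its partial derivatives on `[-4, 4]²`. -/
structure BoundedOnBox (M : ℝ) (F : ℝ × ℝ → ℝ) : Prop where
  contDiff : ContDiff ℝ 1 F
  abs_le : ∀ y ∈ closure openBox, |F y| ≤ M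
  abs_dx_le : ∀ y ∈ closure openBox, |dx F y| ≤ M
  abs_dy_le : ∀ y ∈ closure openBox, |dy F y| ≤ M

lemma isCompact_closure_openBox : IsCompact (closure openBox) := by
  refine (isCompact_Icc.prod isCompact_Icc :
    IsCompact (Icc (-4 : ℝ) 4 ×ˢ Icc (-4 : ℝ) 4)).closure_of_subset ?_
  exact prod_mono Ioo_subset_Icc_self Ioo_subset_Icc_self

lemma smul_mem_closure_openBox {ε : ℝ} (hε : 0 ≤ ε) (hε1 : ε ≤ 1) {y : ℝ × ℝ}
    (hy : y ∈ openBox) : ε • y ∈ closure openBox := by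
  have hconv : Convex ℝ openBox := (convex_Ioo _ _).prod (convex_Ioo _ _)
  refine subset_closure (hconv.smul_mem_of_zero_mem ?_ hy ⟨hε, hε1⟩)
  simp [openBox]

namespace BoundedOnBox

lemma mono {M M' : ℝ} {F : ℝ × ℝ → ℝ} (h : BoundedOnBox M F) (hM : M ≤ M') :
    BoundedOnBox M' F :=
  ⟨h.contDiff, fun y hy => (h.abs_le y hy).trans hM, fun y hy => (h.abs_dx_le y hy).trans hM,
    fun y hy => (h.abs_dy_le y hy).trans hM⟩

lemma exists_of_contDiff {F : ℝ × ℝ → ℝ} (hF : ContDiff ℝ 1 F) :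
    ∃ M, BoundedOnBox M F := by
  obtain ⟨a, ha⟩ := isCompact_closure_openBox.exists_bound_of_continuousOn
    hF.continuous.continuousOn
  obtain ⟨b, hb⟩ := isCompact_closure_openBox.exists_bound_of_continuousOn
    (continuous_dx hF).continuousOn
  obtain ⟨c, hc⟩ := isCompact_closure_openBox.exists_bound_of_continuousOn
    (continuous_dy hF).continuousOn
  exact ⟨max a (max b c), hF, fun y hy => (ha y hy).trans (le_max_left _ _),
    fun y hy => (hb y hy).trans ((le_max_left _ _).trans (le_max_right _ _)),
    fun y hy => (hc y hy).trans ((le_max_right _ _).trans (le_max_right _ _))⟩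

lemma exists_common {ι : Type*} [Finite ι] {F : ι → ℝ × ℝ → ℝ}
    (hF : ∀ i, ContDiff ℝ 1 (F i)) : ∃ M, ∀ i, BoundedOnBox M (F i) := by
  choose m hm using fun i => exists_of_contDiff (hF i)
  obtain ⟨M, hM⟩ := Finite.exists_le m
  exact ⟨M, fun i => (hm i).mono (hM i)⟩

end BoundedOnBox

/-- The function `y ↦ F(εy) Φ(y)`. -/
def scaledMul (ε : ℝ) (F Φ : ℝ × ℝ → ℝ) (y : ℝ × ℝ) : ℝ := F (ε • y) * Φ y

section ScaledMul

variable {ε M : ℝ} {F Φ : ℝ × ℝ → ℝ}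

lemma contDiff_scaledMul (hF : ContDiff ℝ 1 F) (hΦ : ContDiff ℝ 1 Φ) :
    ContDiff ℝ 1 (scaledMul ε F Φ) :=
  (hF.comp (contDiff_const_smul ε)).mul hΦ

lemma tsupport_scaledMul_subset (hs : tsupport Φ ⊆ openBox) :
    tsupport (scaledMul ε F Φ) ⊆ openBox :=
  (tsupport_mul_subset_right (f := fun y => F (ε • y)) (g := Φ)).trans hs

lemma fderiv_scaledMul (hF : ContDiff ℝ 1 F) (hΦ : ContDiff ℝ 1 Φ) (y z : ℝ × ℝ) :
    fderiv ℝ (scaledMul ε F Φ) y z =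
      ε * (fderiv ℝ F (ε • y) z * Φ y) + F (ε • y) * fderiv ℝ Φ y z := by
  have h1 : HasFDerivAt (fun y : ℝ × ℝ => ε • y) (ε • ContinuousLinearMap.id ℝ (ℝ × ℝ)) y :=
    (hasFDerivAt_id y).const_smul ε
  have h2 := ((hF.differentiable one_ne_zero (ε • y)).hasFDerivAt.comp y h1).mul
    (hΦ.differentiable one_ne_zero y).hasFDerivAt
  have h3 : fderiv ℝ (scaledMul ε F Φ) y = _ := h2.fderiv
  rw [h3]
  simp
  ring

lemma dx_scaledMul (hF : ContDiff ℝ 1 F) (hΦ : ContDiff ℝ 1 Φ) (y : ℝ × ℝ) :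
    dx (scaledMul ε F Φ) y = ε * scaledMul ε (dx F) Φ y + scaledMul ε F (dx Φ) y :=
  fderiv_scaledMul hF hΦ y (1, 0)

lemma dy_scaledMul (hF : ContDiff ℝ 1 F) (hΦ : ContDiff ℝ 1 Φ) (y : ℝ × ℝ) :
    dy (scaledMul ε F Φ) y = ε * scaledMul ε (dy F) Φ y + scaledMul ε F (dy Φ) y :=
  fderiv_scaledMul hF hΦ y (0, 1)

lemma abs_scaledMul_le (hε : 0 ≤ ε) (hε1 : ε ≤ 1) (hs : tsupport Φ ⊆ openBox)
    (hF : ∀ y ∈ closure openBox, |F y| ≤ M) (hΦ : ∀ y ∈ closure openBox, |Φ y| ≤ M)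
    (y : ℝ × ℝ) : |scaledMul ε F Φ y| ≤ M ^ 2 := by
  unfold scaledMul
  by_cases hy : y ∈ openBox
  · rw [abs_mul, sq]
    have h1 := hF _ (smul_mem_closure_openBox hε hε1 hy)
    exact mul_le_mul h1 (hΦ _ (subset_closure hy)) (abs_nonneg _) ((abs_nonneg _).trans h1)
  · rw [eq_zero_of_notMem_openBox hs hy, mul_zero, abs_zero]
    positivity

variable (hε : 0 ≤ ε) (hε1 : ε ≤ 1) (hs : tsupport Φ ⊆ openBox) (hF : BoundedOnBox M F)
  (hΦ : BoundedOnBox M Φ)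
include hε hε1 hs hF hΦ

lemma abs_dx_scaledMul_le (y : ℝ × ℝ) : |dx (scaledMul ε F Φ) y| ≤ 2 * M ^ 2 := by
  rw [dx_scaledMul hF.contDiff hΦ.contDiff]
  refine (abs_add_le _ _).trans ?_
  rw [abs_mul, abs_of_nonneg hε]
  nlinarith [abs_scaledMul_le hε hε1 hs hF.abs_dx_le hΦ.abs_le y, sq_nonneg M,
    abs_scaledMul_le hε hε1 (tsupport_dx_subset.trans hs) hF.abs_le hΦ.abs_dx_le y]

lemma abs_dy_scaledMul_le (y : ℝ × ℝ) : |dy (scaledMul ε F Φ) y| ≤ 2 * M ^ 2 := by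
  rw [dy_scaledMul hF.contDiff hΦ.contDiff]
  refine (abs_add_le _ _).trans ?_
  rw [abs_mul, abs_of_nonneg hε]
  nlinarith [abs_scaledMul_le hε hε1 hs hF.abs_dy_le hΦ.abs_le y, sq_nonneg M,
    abs_scaledMul_le hε hε1 (tsupport_dy_subset.trans hs) hF.abs_le hΦ.abs_dy_le y]

lemma smallAmplitude_scaledMul {κ : ℝ} (hκ : ε ≤ κ) :
    SmallAmplitude (2 * M ^ 2 * κ) fun y => ε * scaledMul ε F Φ y := by
  have hc := contDiff_scaledMul (ε := ε) hF.contDiff hΦ.contDiff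
  refine ⟨contDiff_const.mul hc,
    (tsupport_mul_subset_right (f := fun _ => ε)).trans (tsupport_scaledMul_subset hs),
    fun y => ?_, fun y => ?_⟩
  · rw [abs_mul, abs_of_nonneg hε, mul_comm]
    exact mul_le_mul ((abs_scaledMul_le hε hε1 hs hF.abs_le hΦ.abs_le y).trans
      (by nlinarith [sq_nonneg M])) hκ hε (by positivity)
  · have h1 : dy (fun y => ε * scaledMul ε F Φ y) y = ε * dy (scaledMul ε F Φ) y := by
      unfold dy
      rw [fderiv_const_mul (hc.differentiable one_ne_zero y)]
      rfl
    rw [h1, abs_mul, abs_of_nonneg hε, mul_comm]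
    exact mul_le_mul (abs_dy_scaledMul_le hε hε1 hs hF hΦ y) hκ hε (by positivity)

lemma twoScaleAmplitude_scaledMul {κ : ℝ} (hκ : ε ≤ κ) (hΦy : BoundedOnBox M (dy Φ)) :
    TwoScaleAmplitude κ (2 * M ^ 2) (scaledMul ε F Φ) (scaledMul ε F (dy Φ)) where
  contDiff := contDiff_scaledMul hF.contDiff hΦ.contDiff
  tsupport_subset := tsupport_scaledMul_subset hs
  contDiff_main := contDiff_scaledMul hF.contDiff hΦy.contDiff
  tsupport_main_subset := tsupport_scaledMul_subset (tsupport_dy_subset.trans hs)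
  abs_le y := (abs_scaledMul_le hε hε1 hs hF.abs_le hΦ.abs_le y).trans
    (by nlinarith [sq_nonneg M])
  abs_dx_le := abs_dx_scaledMul_le hε hε1 hs hF hΦ
  abs_main_le y := (abs_scaledMul_le hε hε1 (tsupport_dy_subset.trans hs) hF.abs_le
    hΦy.abs_le y).trans (by nlinarith [sq_nonneg M])
  abs_dy_main_le := abs_dy_scaledMul_le hε hε1 (tsupport_dy_subset.trans hs) hF hΦy
  abs_dy_sub_le y := by
    rw [dy_scaledMul hF.contDiff hΦ.contDiff, add_sub_cancel_right, abs_mul, abs_of_nonneg hε,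
      mul_comm]
    exact mul_le_mul ((abs_scaledMul_le hε hε1 hs hF.abs_dy_le hΦ.abs_le y).trans
      (by nlinarith [sq_nonneg M])) hκ hε (by positivity)

end ScaledMul

lemma exists_fragmentAmplitude {f Φ : ℝ × ℝ → ℝ} (hf : ContDiff ℝ 2 f) (hΦ : ContDiff ℝ 3 Φ)
    (hs : tsupport Φ ⊆ openBox) :
    ∃ A, ∀ ε κ, 0 ≤ ε → ε ≤ 1 → ε ≤ κ → FragmentAmplitude κ A (scaledMul ε f Φ)
      (fun y => ε * scaledMul ε (dx f) Φ y) (scaledMul ε f (dx Φ)) (scaledMul ε f (dy (dx Φ)))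
      (fun y => ε * scaledMul ε (dy f) Φ y) (scaledMul ε f (dy Φ)) (scaledMul ε f (dy (dy Φ))) := by
  have hf1 : ContDiff ℝ 1 f := hf.of_le (by norm_num)
  have hfx : ContDiff ℝ 1 (dx f) := contDiff_dx hf (by norm_num)
  have hfy : ContDiff ℝ 1 (dy f) := contDiff_dy hf (by norm_num)
  have hΦ1 : ContDiff ℝ 1 Φ := hΦ.of_le (by norm_num)
  have hΦx : ContDiff ℝ 2 (dx Φ) := contDiff_dx hΦ (by norm_num)
  have hΦy : ContDiff ℝ 2 (dy Φ) := contDiff_dy hΦ (by norm_num)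
  have hΦx1 : ContDiff ℝ 1 (dx Φ) := hΦx.of_le (by norm_num)
  have hΦy1 : ContDiff ℝ 1 (dy Φ) := hΦy.of_le (by norm_num)
  have hΦxy : ContDiff ℝ 1 (dy (dx Φ)) := contDiff_dy hΦx (by norm_num)
  have hΦyy : ContDiff ℝ 1 (dy (dy Φ)) := contDiff_dy hΦy (by norm_num)
  obtain ⟨M, hM⟩ := BoundedOnBox.exists_common
    (F := ![f, dx f, dy f, Φ, dx Φ, dy Φ, dy (dx Φ), dy (dy Φ)])
    (by intro i; fin_cases i <;> assumption)
  have b0 : BoundedOnBox M f := hM 0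
  have b1 : BoundedOnBox M (dx f) := hM 1
  have b2 : BoundedOnBox M (dy f) := hM 2
  have b3 : BoundedOnBox M Φ := hM 3
  have b4 : BoundedOnBox M (dx Φ) := hM 4
  have b5 : BoundedOnBox M (dy Φ) := hM 5
  have b6 : BoundedOnBox M (dy (dx Φ)) := hM 6
  have b7 : BoundedOnBox M (dy (dy Φ)) := hM 7
  refine ⟨2 * M ^ 2, fun ε κ hε hε1 hκ => ?_⟩
  exact
    { contDiff := contDiff_scaledMul hf1 hΦ1
      tsupport_subset := tsupport_scaledMul_subset hs
      abs_le := fun y => (abs_scaledMul_le hε hε1 hs b0.abs_le b3.abs_le y).trans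
        (by nlinarith [sq_nonneg M])
      dx_eq := funext (dx_scaledMul hf1 hΦ1)
      dy_eq := funext (dy_scaledMul hf1 hΦ1)
      small_dx := smallAmplitude_scaledMul hε hε1 hs b1 b3 hκ
      small_dy := smallAmplitude_scaledMul hε hε1 hs b2 b3 hκ
      twoScale_dx := twoScaleAmplitude_scaledMul hε hε1 (tsupport_dx_subset.trans hs) b0 b4 hκ b6
      twoScale_dy := twoScaleAmplitude_scaledMul hε hε1 (tsupport_dy_subset.trans hs) b0 b5 hκ b7 }

lemma exists_edge_bound {E : ℝ → ℝ} (hE : ContDiff ℝ 2 E) (hE' : deriv E 0 = 0) :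
    ∃ K, 1 ≤ K ∧ ∀ N, 1 ≤ N → ContDiff ℝ 2 (fun v => N * E (N⁻¹ * v)) ∧
      (∀ v ∈ Icc (-4 : ℝ) 4, |deriv (fun v => N * E (N⁻¹ * v)) v| ≤ K / N) ∧
      ∀ v ∈ Icc (-4 : ℝ) 4, |deriv (deriv fun v => N * E (N⁻¹ * v)) v| ≤ K / N := by
  have hE1 : ContDiff ℝ 1 (deriv E) :=
    (contDiff_succ_iff_deriv.mp (show ContDiff ℝ (1 + 1) E from by simpa using! hE)).2.2
  obtain ⟨B, hB⟩ := (isCompact_Icc (a := (-4 : ℝ)) (b := 4)).exists_bound_of_continuousOn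
    (hE1.continuous_deriv le_rfl).continuousOn
  have hB0 : 0 ≤ B := (norm_nonneg _).trans (hB 0 (by simp))
  have hlip : ∀ w ∈ Icc (-4 : ℝ) 4, |deriv E w| ≤ B * |w| := by
    intro w hw
    have h1 := (convex_Icc (-4 : ℝ) 4).norm_image_sub_le_of_norm_deriv_le
      (fun x _ => hE1.differentiable one_ne_zero x) hB (show (0 : ℝ) ∈ Icc (-4) 4 by simp) hw
    rwa [hE', sub_zero, sub_zero] at h1
  refine ⟨max 1 (4 * B), le_max_left _ _, fun N hN => ?_⟩
  have hN0 : 0 < N := by linarith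
  have hmem : ∀ v ∈ Icc (-4 : ℝ) 4, N⁻¹ * v ∈ Icc (-4 : ℝ) 4 := by
    intro v hv
    rw [mem_Icc, ← abs_le, abs_mul, abs_inv, abs_of_pos hN0]
    have h1 : N⁻¹ ≤ 1 := inv_le_one_of_one_le₀ hN
    have h2 : |v| ≤ 4 := abs_le.mpr hv
    calc N⁻¹ * |v| ≤ 1 * |v| := mul_le_mul_of_nonneg_right h1 (abs_nonneg v)
      _ ≤ 4 := by rwa [one_mul]
  have hd : ∀ {G : ℝ → ℝ} (v : ℝ), Differentiable ℝ G →
      HasDerivAt (fun v => G (N⁻¹ * v)) (N⁻¹ * deriv G (N⁻¹ * v)) v := by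
    intro G v hG
    have := (hG (N⁻¹ * v)).hasDerivAt.comp v ((hasDerivAt_id v).const_mul N⁻¹)
    refine this.congr_deriv ?_
    ring
  have h1 : (deriv fun v => N * E (N⁻¹ * v)) = fun v => deriv E (N⁻¹ * v) := by
    ext v
    rw [((hd v (hE.differentiable two_ne_zero)).const_mul N).deriv]
    field_simp
  refine ⟨by fun_prop, fun v hv => ?_, fun v hv => ?_⟩
  · rw [h1]
    refine (hlip _ (hmem v hv)).trans ?_
    rw [abs_mul, abs_inv, abs_of_pos hN0, le_div_iff₀ hN0]
    have h2 : |v| ≤ 4 := abs_le.mpr hv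
    calc B * (N⁻¹ * |v|) * N = B * |v| := by field_simp
      _ ≤ B * 4 := by gcongr
      _ ≤ _ := by rw [mul_comm]; exact le_max_right _ _
  · rw [h1, (hd v (hE1.differentiable one_ne_zero)).deriv, abs_mul, abs_inv, abs_of_pos hN0,
      ← div_eq_inv_mul]
    have h2 : |deriv (deriv E) (N⁻¹ * v)| ≤ B := hB _ (hmem v hv)
    have h3 := le_max_right 1 (4 * B)
    gcongr
    linarith

/-- The oscillatory integrals attached to the rescaled edge fragments, uniformly in the scale
and in the direction. -/
lemma exists_planeInt_bound {f Φ : ℝ × ℝ → ℝ} {E : ℝ → ℝ} (hf : ContDiff ℝ 2 f)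
    (hΦ : ContDiff ℝ 3 Φ) (hs : tsupport Φ ⊆ openBox) (hE : ContDiff ℝ 2 E)
    (hE' : deriv E 0 = 0) :
    ∃ C > 0, ∀ N c s : ℝ, 1 ≤ N → c ^ 2 + s ^ 2 = 1 →
      ∫ τ in freqBand N,
        ‖planeInt (fun v => N * E (N⁻¹ * v)) c s (scaledMul N⁻¹ f Φ) τ‖ ^ 2 ≤
      C / (N * (1 + N * |s|) ^ 5) := by
  obtain ⟨A, hA⟩ := exists_fragmentAmplitude hf hΦ hs
  obtain ⟨K, hK, hedge⟩ := exists_edge_bound hE hE'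
  have hb := baseConst_pos
  refine ⟨(64000000 * baseConst + 287649792) * (K ^ 7 * A ^ 2) + 1, by positivity,
    fun N c s hN hcs => ?_⟩
  obtain ⟨h1, h2, h3⟩ := hedge N hN
  have hN0 : 0 < N := by linarith
  have hκ : N⁻¹ ≤ K / N := by
    rw [inv_eq_one_div]
    gcongr
  refine ((hA N⁻¹ (K / N) (by positivity) (inv_le_one_of_one_le₀ hN) hκ).bound hN hK hcs h1 h2
    h3).trans ?_
  gcongr
  linarith

lemma integrable_cexp_mul {g : ℝ × ℝ → ℂ} {p : ℝ × ℝ → ℝ} (hg : Integrable g)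
    (hp : Continuous p) :
    Integrable fun ξ => g ξ * Complex.exp (-Complex.I * ((p ξ : ℝ) : ℂ)) := by
  refine hg.mul_bdd (c := 1) (Continuous.aestronglyMeasurable (by fun_prop)) ?_
  exact Filter.Eventually.of_forall fun ξ => (norm_cexp_neg_I_mul _).le

lemma hasDerivAt_integral_mul_cexp {g : ℝ × ℝ → ℂ} {m b : ℝ × ℝ → ℝ} (hg : Integrable g)
    (hm : Continuous m) (hb : Continuous b) (hmg : Integrable fun ξ => -Complex.I * m ξ * g ξ)
    (t : ℝ) :
    HasDerivAt (fun t : ℝ => ∫ ξ, g ξ * Complex.exp (-Complex.I * ((m ξ * t + b ξ : ℝ) : ℂ)))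
      (∫ ξ, (-Complex.I * m ξ * g ξ) * Complex.exp (-Complex.I * ((m ξ * t + b ξ : ℝ) : ℂ))) t := by
  refine (hasDerivAt_integral_of_dominated_loc_of_deriv_le (μ := volume)
    (bound := fun ξ => ‖-Complex.I * m ξ * g ξ‖)
    (F := fun (t : ℝ) ξ => g ξ * Complex.exp (-Complex.I * ((m ξ * t + b ξ : ℝ) : ℂ)))
    (F' := fun (t : ℝ) ξ => (-Complex.I * m ξ * g ξ) *
      Complex.exp (-Complex.I * ((m ξ * t + b ξ : ℝ) : ℂ)))
    Filter.univ_mem (Filter.Eventually.of_forall fun t =>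
      (integrable_cexp_mul hg (by fun_prop)).aestronglyMeasurable)
    (integrable_cexp_mul hg (by fun_prop))
    (integrable_cexp_mul hmg (by fun_prop)).aestronglyMeasurable
    (Filter.Eventually.of_forall fun ξ t _ => ?_) hmg.norm
    (Filter.Eventually.of_forall fun ξ t _ => ?_)).2
  · rw [norm_mul, norm_cexp_neg_I_mul, mul_one]
  · have h1 : HasDerivAt (fun t : ℝ => m ξ * t + b ξ) (m ξ) t := by
      simpa using! ((hasDerivAt_id t).const_mul (m ξ)).add_const (b ξ)
    refine (((h1.ofReal_comp.const_mul (-Complex.I)).cexp).const_mul (g ξ)).congr_deriv ?_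
    ring

/-- Integrable functions vanishing outside a compact set. -/
structure CompactlyIntegrable (g : ℝ × ℝ → ℂ) : Prop where
  integrable : Integrable g
  hasCompactSupport : HasCompactSupport g

namespace CompactlyIntegrable

variable {g : ℝ × ℝ → ℂ}

lemma continuous_mul (hg : CompactlyIntegrable g) {m : ℝ × ℝ → ℂ} (hm : Continuous m) :
    CompactlyIntegrable fun ξ => m ξ * g ξ := by
  refine ⟨?_, hg.hasCompactSupport.mul_left⟩
  have h1 : IntegrableOn (fun ξ => m ξ * g ξ) (tsupport g) :=
    (hg.integrable.integrableOn).continuousOn_mul hm.continuousOn hg.hasCompactSupport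
  refine (integrableOn_iff_integrable_of_support_subset fun ξ hξ => ?_).mp h1
  exact subset_tsupport g (right_ne_zero_of_mul hξ)

lemma pd1_FT (hg : CompactlyIntegrable g) :
    pd1 (FT g) = FT fun ξ => (-Complex.I * ξ.1) * g ξ := by
  ext x
  have h1 := (hasDerivAt_integral_mul_cexp (m := fun ξ => ξ.1) (b := fun ξ => ξ.2 * x.2)
    hg.integrable (by fun_prop) (by fun_prop)
    (hg.continuous_mul (m := fun ξ => -Complex.I * ξ.1) (by fun_prop)).integrable x.1).const_mul
      (((2 * π) ^ 2 : ℂ)⁻¹)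
  exact h1.deriv

lemma pd2_FT (hg : CompactlyIntegrable g) :
    pd2 (FT g) = FT fun ξ => (-Complex.I * ξ.2) * g ξ := by
  ext x
  have h1 := (hasDerivAt_integral_mul_cexp (m := fun ξ => ξ.2) (b := fun ξ => ξ.1 * x.1)
    hg.integrable (by fun_prop) (by fun_prop)
    (hg.continuous_mul (m := fun ξ => -Complex.I * ξ.2) (by fun_prop)).integrable x.2).const_mul
      (((2 * π) ^ 2 : ℂ)⁻¹)
  simp only [add_comm (_ * _) (_ * x.1)] at h1
  exact h1.deriv

lemma iterate_pd1_FT (hg : CompactlyIntegrable g) (n : ℕ) :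
    pd1^[n] (FT g) = FT fun ξ => (-Complex.I * ξ.1) ^ n * g ξ := by
  induction n with
  | zero => simp
  | succ n ih =>
    rw [Function.iterate_succ_apply', ih, (hg.continuous_mul (by fun_prop)).pd1_FT]
    congr 1
    ext ξ
    ring

lemma iterate_pd2_FT (hg : CompactlyIntegrable g) (n : ℕ) :
    pd2^[n] (FT g) = FT fun ξ => (-Complex.I * ξ.2) ^ n * g ξ := by
  induction n with
  | zero => simp
  | succ n ih =>
    rw [Function.iterate_succ_apply', ih, (hg.continuous_mul (by fun_prop)).pd2_FT]
    congr 1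
    ext ξ
    ring

/-- Partial derivatives of the Fourier transform correspond to multiplication by monomials. -/
lemma norm_pd_FT (hg : CompactlyIntegrable g) (r : ℕ × ℕ) (x : ℝ × ℝ) :
    ‖pd r (FT g) x‖ = ‖FT (fun ξ => ((ξ.1 ^ r.1 * ξ.2 ^ r.2 : ℝ) : ℂ) * g ξ) x‖ := by
  unfold pd
  rw [hg.iterate_pd2_FT, (hg.continuous_mul (by fun_prop)).iterate_pd1_FT]
  have h1 : FT (fun ξ => (-Complex.I * ξ.1) ^ r.1 * ((-Complex.I * ξ.2) ^ r.2 * g ξ)) x =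
      (-Complex.I) ^ (r.1 + r.2) * FT (fun ξ => ((ξ.1 ^ r.1 * ξ.2 ^ r.2 : ℝ) : ℂ) * g ξ) x := by
    unfold FT
    rw [mul_left_comm, ← integral_const_mul ((-Complex.I) ^ (r.1 + r.2))]
    congr 1
    refine integral_congr_ae (Filter.Eventually.of_forall fun ξ => ?_)
    push_cast
    ring
  rw [h1, norm_mul, norm_pow, norm_neg, Complex.norm_I, one_pow, one_mul]

end CompactlyIntegrable

lemma hasCompactSupport_mul_comp_smul {f φ : ℝ × ℝ → ℝ} (hs : HasCompactSupport φ) {N : ℝ}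
    (hN : N ≠ 0) : HasCompactSupport fun x : ℝ × ℝ => f x * φ (N * x.1, N * x.2) := by
  have h1 : HasCompactSupport fun x : ℝ × ℝ => φ (N • x) := hs.comp_smul hN
  refine h1.mono fun x hx => ?_
  exact right_ne_zero_of_mul hx

lemma compactlyIntegrable_edgeFragment {f φ : ℝ × ℝ → ℝ} {E : ℝ → ℝ} (hf : Continuous f)
    (hφ : Continuous φ) (hs : HasCompactSupport φ) (hE : Continuous E) (j : ℕ) :
    CompactlyIntegrable fun x => (edgeFragment f φ E j x : ℂ) := by
  have hN : (2 : ℝ) ^ ((j : ℝ) / 2) ≠ 0 := (Real.rpow_pos_of_pos two_pos _).ne'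
  have h1 : HasCompactSupport fun x : ℝ × ℝ =>
      f x * φ ((2 : ℝ) ^ ((j : ℝ) / 2) * x.1, (2 : ℝ) ^ ((j : ℝ) / 2) * x.2) :=
    hasCompactSupport_mul_comp_smul hs hN
  have hm : MeasurableSet {x : ℝ × ℝ | E x.2 ≤ x.1} :=
    measurableSet_le (by fun_prop) (by fun_prop)
  have h2 : edgeFragment f φ E j = indicator {x : ℝ × ℝ | E x.2 ≤ x.1} fun x =>
      f x * φ ((2 : ℝ) ^ ((j : ℝ) / 2) * x.1, (2 : ℝ) ^ ((j : ℝ) / 2) * x.2) := by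
    ext x
    simp [edgeFragment, indicator_apply]
  have h3 : Integrable (edgeFragment f φ E j) := by
    rw [h2]
    exact (Continuous.integrable_of_hasCompactSupport (by fun_prop) h1).indicator hm
  refine ⟨h3.ofReal, ?_⟩
  have h4 : HasCompactSupport (edgeFragment f φ E j) := by
    refine h1.mono fun x hx => ?_
    exact left_ne_zero_of_mul hx
  exact h4.comp_left (g := Complex.ofReal) Complex.ofReal_zero

lemma FT_monomial_mul_edgeFragment {f φ : ℝ × ℝ → ℝ} {E : ℝ → ℝ} {j : ℕ} (r : ℕ × ℕ)
    (hs : tsupport φ ⊆ openBox) (hE : Continuous E) {N : ℝ} (hN : N = (2 : ℝ) ^ ((j : ℝ) / 2))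
    (c s ρ : ℝ) :
    FT (fun ξ => ((ξ.1 ^ r.1 * ξ.2 ^ r.2 : ℝ) : ℂ) * (edgeFragment f φ E j ξ : ℂ))
      (ρ * c, ρ * s) =
    ((2 * π) ^ 2 : ℂ)⁻¹ * ((N⁻¹ ^ (2 + r.1 + r.2) : ℝ) : ℂ) *
      planeInt (fun v => N * E (N⁻¹ * v)) c s
        (scaledMul N⁻¹ f fun y => y.1 ^ r.1 * y.2 ^ r.2 * φ y) (N⁻¹ * ρ) := by
  have hN0 : 0 < N := by
    rw [hN]
    positivity
  have hes : Continuous fun v => N * E (N⁻¹ * v) := by fun_prop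
  set G : ℝ × ℝ → ℂ := fun ξ => ((ξ.1 ^ r.1 * ξ.2 ^ r.2 : ℝ) : ℂ) * (edgeFragment f φ E j ξ : ℂ) *
    Complex.exp (-Complex.I * ((ξ.1 * (ρ * c) + ξ.2 * (ρ * s) : ℝ) : ℂ)) with hG
  have hplane : planeInt (fun v => N * E (N⁻¹ * v)) c s
      (scaledMul N⁻¹ f fun y => y.1 ^ r.1 * y.2 ^ r.2 * φ y) (N⁻¹ * ρ) =
      ∫ y, ((N ^ (r.1 + r.2) : ℝ) : ℂ) * G (N⁻¹ • y) := by
    unfold planeInt oscInt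
    rw [integral_planeMeasure hes fun y hy => by
      simp [scaledMul, eq_zero_of_notMem_openBox hs hy],
      ← integral_indicator (measurableSet_edgeRegion hes)]
    congr 1
    ext y
    have hiff : N * E (N⁻¹ * y.2) ≤ y.1 ↔ E (N⁻¹ * y.2) ≤ N⁻¹ * y.1 := by
      rw [← div_eq_inv_mul y.1, le_div_iff₀ hN0, mul_comm]
    have hphase : (N⁻¹ * ρ) * (c * y.1 + s * y.2) =
        N⁻¹ * y.1 * (ρ * c) + N⁻¹ * y.2 * (ρ * s) := by ring
    simp only [hG, indicator_apply, mem_ofPred_eq, edgeFragment, scaledMul, Prod.smul_fst,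
      Prod.smul_snd, smul_eq_mul, ← hN, mul_inv_cancel_left₀ hN0.ne', hiff, hphase]
    have hpow : (N ^ (r.1 + r.2) : ℝ) * ((N⁻¹ * y.1) ^ r.1 * (N⁻¹ * y.2) ^ r.2) =
        y.1 ^ r.1 * y.2 ^ r.2 := by
      rw [mul_pow, mul_pow, pow_add, inv_pow, inv_pow]
      field_simp
    split_ifs
    · have hamp : f (N⁻¹ • y) * y.1 ^ r.1 * y.2 ^ r.2 * φ y = N ^ (r.1 + r.2) *
          ((N⁻¹ * y.1) ^ r.1 * (N⁻¹ * y.2) ^ r.2 * (f (N⁻¹ • y) * φ (y.1, y.2) * 1)) := by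
        linear_combination (-f (N⁻¹ • y) * φ y) * hpow
      simp only [← mul_assoc] at hamp ⊢
      rw [hamp]
      push_cast
      ring
    · simp
  have hscale : ∫ y, G (N⁻¹ • y) = ((N ^ 2 : ℝ) : ℂ) * ∫ ξ, G ξ := by
    rw [Measure.integral_comp_smul volume G N⁻¹, Module.finrank_prod, Module.finrank_self,
      Complex.real_smul, abs_of_pos (by positivity), inv_pow, inv_inv]
  have hinv : (((N⁻¹ ^ (2 + r.1 + r.2) : ℝ) : ℂ)) * (((N ^ (r.1 + r.2) : ℝ) : ℂ) *
      ((N ^ 2 : ℝ) : ℂ)) = 1 := by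
    rw [← Complex.ofReal_mul, ← Complex.ofReal_mul, ← pow_add, inv_pow,
      show r.1 + r.2 + 2 = 2 + r.1 + r.2 by ring, inv_mul_cancel₀ (by positivity),
      Complex.ofReal_one]
  rw [hplane, integral_const_mul, hscale]
  unfold FT
  simp only []
  linear_combination (-((2 * π) ^ 2 : ℂ)⁻¹ * ∫ ξ, G ξ) * hinv

lemma setIntegral_comp_inv_mul_freqBand {N : ℝ} (hN : 0 < N) (H : ℝ → ℝ) :
    ∫ ρ in {ρ : ℝ | |ρ| ∈ Icc (N ^ 2 / 2) (2 * N ^ 2)}, H (N⁻¹ * ρ) =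
      N * ∫ τ in freqBand N, H τ := by
  have hset : {ρ : ℝ | |ρ| ∈ Icc (N ^ 2 / 2) (2 * N ^ 2)} =
      (fun ρ => N⁻¹ * ρ) ⁻¹' freqBand N := by
    ext ρ
    simp only [freqBand, mem_ofPred_eq, mem_preimage, mem_Icc, ← div_eq_inv_mul]
    rw [abs_div, abs_of_pos hN, le_div_iff₀ hN, div_le_iff₀ hN]
    refine and_congr (by ring_nf) (by ring_nf)
  have hm := measurableSet_freqBand N
  rw [hset, ← integral_indicator (measurable_const_mul _ hm), ← integral_indicator hm]
  have h1 := Measure.integral_comp_mul_left ((freqBand N).indicator H) N⁻¹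
  rw [inv_inv, abs_of_pos hN, smul_eq_mul] at h1
  rw [← h1]
  rfl

lemma tsupport_monomial_mul_subset_openBox {φ : ℝ × ℝ → ℝ}
    (hs : tsupport φ ⊆ Icc (-π) π ×ˢ Icc (-π) π) (r : ℕ × ℕ) :
    tsupport (fun y : ℝ × ℝ => y.1 ^ r.1 * y.2 ^ r.2 * φ y) ⊆ openBox := by
  have hsub : Icc (-π) π ⊆ Ioo (-4 : ℝ) 4 := fun t ht =>
    ⟨by linarith [ht.1, pi_lt_four], by linarith [ht.2, pi_lt_four]⟩
  exact (tsupport_mul_subset_right.trans hs).trans (prod_mono hsub hsub)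

lemma norm_pd_FT_edgeFragment {f φ : ℝ × ℝ → ℝ} {E : ℝ → ℝ} {j : ℕ} (hf : Continuous f)
    (hφ : Continuous φ) (hs : tsupport φ ⊆ openBox) (hE : Continuous E) (r : ℕ × ℕ) {N : ℝ}
    (hN : N = (2 : ℝ) ^ ((j : ℝ) / 2)) (c s ρ : ℝ) :
    ‖pd r (FT fun x => (edgeFragment f φ E j x : ℂ)) (ρ * c, ρ * s)‖ =
      ((2 * π) ^ 2)⁻¹ * N⁻¹ ^ (2 + r.1 + r.2) *
        ‖planeInt (fun v => N * E (N⁻¹ * v)) c s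
          (scaledMul N⁻¹ f fun y => y.1 ^ r.1 * y.2 ^ r.2 * φ y) (N⁻¹ * ρ)‖ := by
  have hN0 : 0 < N := by
    rw [hN]
    positivity
  rw [(compactlyIntegrable_edgeFragment hf hφ (hasCompactSupport_of_tsupport_subset_openBox hs)
    hE j).norm_pd_FT, FT_monomial_mul_edgeFragment r hs hE hN, norm_mul, norm_mul,
    Complex.norm_of_nonneg (by positivity)]
  congr 2
  rw [norm_inv, norm_pow, norm_mul, Complex.norm_of_nonneg pi_pos.le, Complex.norm_two]

/-- Radial integral bound for the Fourier transform of a standard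
edge fragment `ℰ_j`: for angles `θ, γ ∈ [0,2π)` and any multi-index `r`,
`∫_{|ρ|∈[2^{j-1},2^{j+1}]} |∂^r[𝓕ℰ_j](ρΘ(θ−γ))|² dρ
  ≤ C(r) 2^{-j(2+|r|₁)} (1 + 2^{j/2}|sin(θ−γ)|)^{-5}`. -/
theorem int_FT_edge_radial (φ : ℝ × ℝ → ℝ) (hφ : ContDiff ℝ (⊤ : ℕ∞) φ)
    (hφs : tsupport φ ⊆ Icc (-π) π ×ˢ Icc (-π) π)
    (E : ℝ → ℝ) (hE : ContDiff ℝ 2 E) (hE0 : E 0 = 0) (hE0' : deriv E 0 = 0)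
    (f : ℝ × ℝ → ℝ) (hf : ContDiff ℝ 2 f) (r : ℕ × ℕ) :
    ∃ C > 0, ∀ j : ℕ, 1 ≤ j → ∀ θ ∈ Ico (0:ℝ) (2*π), ∀ γ ∈ Ico (0:ℝ) (2*π),
      (∫ ρ in {ρ : ℝ | |ρ| ∈ Icc ((2:ℝ)^((j:ℝ)-1)) ((2:ℝ)^((j:ℝ)+1))},
          ‖pd r (FT (fun x => (edgeFragment f φ E j x : ℂ)))
              (ρ * Real.cos (θ-γ), ρ * Real.sin (θ-γ))‖^2)
        ≤ C * (2:ℝ)^(-(j:ℝ)*(2+(r.1:ℝ)+(r.2:ℝ)))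
            * (1 + (2:ℝ)^((j:ℝ)/2) * |Real.sin (θ-γ)|)^(-(5:ℝ)) := by
  set Φ : ℝ × ℝ → ℝ := fun y => y.1 ^ r.1 * y.2 ^ r.2 * φ y with hΦ
  have hφ3 : ContDiff ℝ 3 φ := hφ.of_le (WithTop.coe_le_coe.mpr (le_top : (3 : ℕ∞) ≤ ⊤))
  have hs : tsupport φ ⊆ openBox := by
    simpa using tsupport_monomial_mul_subset_openBox hφs (0, 0)
  obtain ⟨C, hC, hbound⟩ := exists_planeInt_bound (Φ := Φ) hf
    (by fun_prop) (tsupport_monomial_mul_subset_openBox hφs r) hE hE0'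
  refine ⟨C, hC, fun j _ θ _ γ _ => ?_⟩
  obtain ⟨N, hN⟩ : ∃ N, N = (2 : ℝ) ^ ((j : ℝ) / 2) := ⟨_, rfl⟩
  have hN1 : 1 ≤ N := hN ▸ Real.one_le_rpow one_le_two (by positivity)
  have hN0 : 0 < N := one_pos.trans_le hN1
  have hNpow (n : ℕ) : N ^ n = (2 : ℝ) ^ ((j : ℝ) / 2 * n) := by
    rw [hN, Real.rpow_mul two_pos.le, Real.rpow_natCast]
  have hN2 : N ^ 2 = (2 : ℝ) ^ (j : ℝ) := by
    rw [hNpow]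
    congr 1
    push_cast
    ring
  have hlow : (2 : ℝ) ^ ((j : ℝ) - 1) = N ^ 2 / 2 := by
    rw [Real.rpow_sub two_pos, Real.rpow_one, hN2]
  have hupp : (2 : ℝ) ^ ((j : ℝ) + 1) = 2 * N ^ 2 := by
    rw [Real.rpow_add two_pos, Real.rpow_one, hN2, mul_comm]
  have hdecay : (2 : ℝ) ^ (-(j : ℝ) * (2 + (r.1 : ℝ) + (r.2 : ℝ))) =
      (N⁻¹ ^ (2 + r.1 + r.2)) ^ 2 := by
    rw [inv_pow, inv_pow, ← pow_mul, hNpow, ← Real.rpow_neg two_pos.le]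
    congr 1
    push_cast
    ring
  have hc : ((2 * π) ^ 2)⁻¹ ≤ 1 := inv_le_one_of_one_le₀ (by nlinarith [pi_gt_three])
  set s := Real.sin (θ - γ)
  set c := Real.cos (θ - γ)
  have hang : (1 + N * |s|) ^ (-(5 : ℝ)) = ((1 + N * |s|) ^ 5)⁻¹ := by
    rw [Real.rpow_neg (by positivity)]
    norm_cast
  simp only [norm_pd_FT_edgeFragment hf.continuous hφ.continuous hs hE.continuous r hN]
  rw [hlow, hupp, ← hN, hdecay, hang, setIntegral_comp_inv_mul_freqBand hN0 fun τ =>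
    (((2 * π) ^ 2)⁻¹ * N⁻¹ ^ (2 + r.1 + r.2) *
      ‖planeInt (fun v => N * E (N⁻¹ * v)) c s (scaledMul N⁻¹ f Φ) τ‖) ^ 2]
  simp only [mul_pow _ ‖_‖, integral_const_mul]
  calc N * ((((2 * π) ^ 2)⁻¹ * N⁻¹ ^ (2 + r.1 + r.2)) ^ 2 * ∫ τ in freqBand N,
        ‖planeInt (fun v => N * E (N⁻¹ * v)) c s (scaledMul N⁻¹ f Φ) τ‖ ^ 2)
      ≤ N * ((1 * N⁻¹ ^ (2 + r.1 + r.2)) ^ 2 * (C / (N * (1 + N * |s|) ^ 5))) := by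
        gcongr
        exact hbound N c s hN1 (Real.cos_sq_add_sin_sq _)
    _ = C * (N⁻¹ ^ (2 + r.1 + r.2)) ^ 2 * ((1 + N * |s|) ^ 5)⁻¹ := by
        have h1 : 0 < 1 + N * |s| := by positivity
        generalize 1 + N * |s| = a at h1
        field_simp

end
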